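/- arXiv:1902.00207 — 4 statements merged into one kernel-verified Lean document; each statement's English description precedes it below -/
import Mathlib

section
/- Let 𝔭 be a Lie algebra over ℂ equipped with a ℤ-grading and let a ∈ 𝔭. If for every restricted 𝔭-module W and every w ∈ W one has a · w = 0, then a = 0. -/
section PoincareBirkhoffWitt

variable {R L ι : Type*} [CommRing R] [LieRing L] [LieAlgebra R L] [LinearOrder ι]

/-- The number of inversions of a list. -/
def inversions : List ι → ℕ
  | [] => 0
  | a :: l => l.countP (fun x => x < a) + inversions l

/-- Lists are compared by length first and by number of inversions second. -/
def inversionRank (l : List ι) : ℕ ×ₗ ℕ := toLex (l.length, inversions l)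

theorem inversions_swap_lt (p r : List ι) {i j : ι} (h : j < i) :
    inversions (p ++ j :: i :: r) < inversions (p ++ i :: j :: r) := by
  induction p with
  | nil =>
    simp only [List.nil_append, inversions, List.countP_cons, h, h.not_gt, decide_true,
      decide_false, if_true]
    simp
    omega
  | cons a p ih =>
    simp only [List.cons_append, inversions, List.countP_append, List.countP_cons]
    omega

theorem inversionRank_swap_lt (p r : List ι) {i j : ι} (h : j < i) :
    inversionRank (p ++ j :: i :: r) < inversionRank (p ++ i :: j :: r) := by
  rw [inversionRank, inversionRank, Prod.Lex.toLex_lt_toLex]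
  exact Or.inr ⟨by simp, inversions_swap_lt p r h⟩

theorem inversionRank_lt_of_length_lt {l m : List ι} (h : l.length < m.length) :
    inversionRank l < inversionRank m := by
  rw [inversionRank, inversionRank, Prod.Lex.toLex_lt_toLex]
  exact Or.inl h

/-- For a function `G` on words in a basis, the linear form `v ↦ G (p v r)`. -/
noncomputable def wordForm (b : Module.Basis ι R L) (G : List ι → R) (p r : List ι) :
    L →ₗ[R] R :=
  b.constr R fun k => G (p ++ k :: r)

omit [LinearOrder ι] in
@[simp]
theorem wordForm_basis (b : Module.Basis ι R L) (G : List ι → R) (p r : List ι) (k : ι) :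
    wordForm b G p r (b k) = G (p ++ k :: r) := by
  simp [wordForm]

/-- The words in which two consecutive letters are in decreasing order. -/
def HasDescent (l : List ι) : Prop :=
  ∃ d : List ι × ι × ι × List ι, d.2.2.1 < d.2.1 ∧ l = d.1 ++ d.2.1 :: d.2.2.1 :: d.2.2.2

open Classical in
/-- The value of a word under straightening, given values `f` of the sorted words. -/
noncomputable def straighten (b : Module.Basis ι R L) (f : List ι → R) (l : List ι) : R :=
  if h : HasDescent l then
    straighten b f (h.choose.1 ++ h.choose.2.2.1 :: h.choose.2.1 :: h.choose.2.2.2) +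
      (b.repr ⁅b h.choose.2.1, b h.choose.2.2.1⁆).sum fun k a =>
        a • straighten b f (h.choose.1 ++ k :: h.choose.2.2.2)
  else f l
termination_by inversionRank l
decreasing_by
  · conv_rhs => rw [h.choose_spec.2]
    exact inversionRank_swap_lt _ _ h.choose_spec.1
  · conv_rhs => rw [h.choose_spec.2]
    exact inversionRank_lt_of_length_lt (by simp)

theorem straighten_of_not_hasDescent (b : Module.Basis ι R L) (f : List ι → R) {l : List ι}
    (h : ¬ HasDescent l) : straighten b f l = f l := by
  rw [straighten, dif_neg h]

theorem exists_straighten_eq (b : Module.Basis ι R L) (f : List ι → R) {l : List ι}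
    (h : HasDescent l) : ∃ p i j r, j < i ∧ l = p ++ i :: j :: r ∧
      straighten b f l = straighten b f (p ++ j :: i :: r) +
        wordForm b (straighten b f) p r ⁅b i, b j⁆ := by
  refine ⟨_, _, _, _, h.choose_spec.1, h.choose_spec.2, ?_⟩
  rw [straighten, dif_pos h, wordForm, Module.Basis.constr_apply]

section Confluence

variable (b : Module.Basis ι R L) (G : List ι → R) (l : List ι)
  (ih : ∀ p i j r, j < i → inversionRank (p ++ i :: j :: r) < inversionRank l →
    G (p ++ i :: j :: r) = G (p ++ j :: i :: r) + wordForm b G p r ⁅b i, b j⁆)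

include ih

theorem wordForm_cons_of_length_lt (p r : List ι) (h : p.length + r.length + 2 < l.length)
    (i : ι) (v : L) :
    wordForm b G p (i :: r) v = wordForm b G (p ++ [i]) r v + wordForm b G p r ⁅v, b i⁆ := by
  have key : wordForm b G p (i :: r) = wordForm b G (p ++ [i]) r -
      wordForm b G p r ∘ₗ (LieAlgebra.ad R L (b i) : L →ₗ[R] L) := by
    refine b.ext fun k => ?_
    have hlen : ∀ x y, inversionRank (p ++ x :: y :: r) < inversionRank l := fun x y =>
      inversionRank_lt_of_length_lt (by simp; omega)
    simp only [wordForm_basis, LinearMap.sub_apply, LinearMap.comp_apply, LieAlgebra.ad_apply,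
      List.append_assoc, List.singleton_append]
    rcases lt_trichotomy i k with hik | rfl | hik
    · rw [ih p k i r hik (hlen _ _), ← lie_skew (b i) (b k), map_neg]
      simp
    · simp
    · rw [ih p i k r hik (hlen _ _)]
      simp
  rw [key, ← lie_skew v (b i), map_neg, ← sub_eq_add_neg]
  simp

theorem confluence_overlap (p r : List ι) {i j k : ι} (hij : j < i) (hjk : k < j)
    (hl : l = p ++ i :: j :: k :: r) :
    G (p ++ j :: i :: k :: r) + wordForm b G p (k :: r) ⁅b i, b j⁆ =
      G (p ++ i :: k :: j :: r) + wordForm b G (p ++ [i]) r ⁅b j, b k⁆ := by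
  have hs := wordForm_cons_of_length_lt b G l ih p r (by subst hl; simp; omega)
  have r1 : inversionRank (p ++ j :: i :: k :: r) < inversionRank l :=
    hl ▸ inversionRank_swap_lt p (k :: r) hij
  have r2 : inversionRank (p ++ i :: k :: j :: r) < inversionRank l := by
    have := inversionRank_swap_lt (p ++ [i]) r hjk
    simpa [hl] using this
  have r3 : inversionRank (p ++ j :: k :: i :: r) < inversionRank l := by
    have := inversionRank_swap_lt (p ++ [j]) r (hjk.trans hij)
    simp only [List.append_assoc, List.singleton_append] at this
    exact this.trans r1
  have r4 : inversionRank (p ++ k :: i :: j :: r) < inversionRank l :=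
    (inversionRank_swap_lt p (j :: r) (hjk.trans hij)).trans r2
  have e1 := ih (p ++ [j]) i k r (hjk.trans hij) (by simpa using r1)
  have e2 := ih p j k (i :: r) hjk r3
  have e3 := ih p i k (j :: r) (hjk.trans hij) r2
  have e4 := ih (p ++ [k]) i j r hij (by simpa using r4)
  simp only [List.append_assoc, List.singleton_append] at e1 e4
  rw [e1, e2, e3, e4, hs i, hs j, hs k]
  have jac : ⁅⁅b i, b k⁆, b j⁆ = ⁅⁅b j, b k⁆, b i⁆ + ⁅⁅b i, b j⁆, b k⁆ := by
    have := lie_jacobi (b i) (b j) (b k)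
    rw [← lie_skew (b i) ⁅b j, b k⁆, ← lie_skew (b j) ⁅b k, b i⁆, ← lie_skew (b k) ⁅b i, b j⁆,
      ← lie_skew (b k) (b i), neg_lie, neg_neg] at this
    rw [← sub_eq_zero, ← this]
    abel
  rw [jac, map_add]
  ring

theorem confluence_disjoint (p q r : List ι) {i j x y : ι} (hij : j < i) (hxy : y < x)
    (hl : l = p ++ i :: j :: (q ++ x :: y :: r)) :
    G (p ++ j :: i :: (q ++ x :: y :: r)) +
        wordForm b G p (q ++ x :: y :: r) ⁅b i, b j⁆ =
      G (p ++ i :: j :: (q ++ y :: x :: r)) +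
        wordForm b G (p ++ i :: j :: q) r ⁅b x, b y⁆ := by
  let B : L →ₗ[R] L →ₗ[R] R := b.constr R fun k => wordForm b G (p ++ k :: q) r
  have hB : ∀ k, B (b k) = wordForm b G (p ++ k :: q) r := fun k => by simp [B]
  have hB' : ∀ m v, B v (b m) = wordForm b G p (q ++ m :: r) v := by
    intro m v
    have : B.flip (b m) = wordForm b G p (q ++ m :: r) :=
      b.ext fun k => by simp [hB]
    rw [← this, LinearMap.flip_apply]
  have e1 := ih (p ++ j :: i :: q) x y r hxy (by
    have := inversionRank_swap_lt p (q ++ x :: y :: r) hij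
    simpa [hl] using this)
  have e2 := ih p i j (q ++ y :: x :: r) hij (by
    have := inversionRank_swap_lt (p ++ i :: j :: q) r hxy
    simpa [hl] using this)
  have e3 : wordForm b G p (q ++ x :: y :: r) =
      wordForm b G p (q ++ y :: x :: r) + B.flip ⁅b x, b y⁆ := by
    refine b.ext fun k => ?_
    have := ih (p ++ k :: q) x y r hxy
      (inversionRank_lt_of_length_lt (by subst hl; simp))
    simpa [hB] using this
  have e4 : wordForm b G (p ++ i :: j :: q) r =
      wordForm b G (p ++ j :: i :: q) r + B ⁅b i, b j⁆ := by
    refine b.ext fun k => ?_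
    have := ih p i j (q ++ k :: r) hij
      (inversionRank_lt_of_length_lt (by subst hl; simp))
    simpa [hB'] using this
  simp only [List.append_assoc, List.cons_append] at e1
  rw [e1, e2, e3, e4]
  simp only [LinearMap.add_apply, LinearMap.flip_apply]
  ring

theorem confluence (p p' r r' : List ι) {i j i' j' : ι} (h : j < i) (h' : j' < i')
    (hl : l = p ++ i :: j :: r) (hl' : l = p' ++ i' :: j' :: r') :
    G (p ++ j :: i :: r) + wordForm b G p r ⁅b i, b j⁆ =
      G (p' ++ j' :: i' :: r') + wordForm b G p' r' ⁅b i', b j'⁆ := by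
  have aux : ∀ (p q r r' : List ι) {i j i' j' : ι} (_ : j < i) (_ : j' < i')
      (_ : l = p ++ i :: j :: r) (_ : i :: j :: r = q ++ i' :: j' :: r'),
      G (p ++ j :: i :: r) + wordForm b G p r ⁅b i, b j⁆ =
        G (p ++ q ++ j' :: i' :: r') + wordForm b G (p ++ q) r' ⁅b i', b j'⁆ := by
    intro p q r r' i j i' j' h h' hl hq
    match q with
    | [] =>
      simp only [List.nil_append, List.cons.injEq] at hq
      obtain ⟨rfl, rfl, rfl⟩ := hq
      simp
    | [x] =>
      simp only [List.cons_append, List.nil_append, List.cons.injEq] at hq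
      obtain ⟨rfl, rfl, rfl⟩ := hq
      simpa using confluence_overlap b G l ih p r' h h' hl
    | x :: y :: q =>
      simp only [List.cons_append, List.cons.injEq] at hq
      obtain ⟨rfl, rfl, rfl⟩ := hq
      simpa using confluence_disjoint b G l ih p q r' h h' hl
  rcases List.append_eq_append_iff.1 (hl.symm.trans hl') with ⟨q, rfl, hq⟩ | ⟨q, rfl, hq⟩
  · exact aux p q r r' h h' hl hq
  · exact (aux p' q r' r h' h hl' hq).symm

end Confluence

theorem straighten_descent (b : Module.Basis ι R L) (f : List ι → R) (l : List ι) :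
    ∀ p i j r, j < i → l = p ++ i :: j :: r →
      straighten b f (p ++ i :: j :: r) = straighten b f (p ++ j :: i :: r) +
        wordForm b (straighten b f) p r ⁅b i, b j⁆ := by
  induction l using (InvImage.wf (inversionRank (ι := ι)) wellFounded_lt).induction with
  | _ l ih =>
  intro p i j r hij hl
  obtain ⟨p', i', j', r', hij', hl', e⟩ :=
    exists_straighten_eq b f (l := l) ⟨(p, i, j, r), hij, hl⟩
  rw [← hl, e]
  exact confluence b _ l (fun p i j r h hlt => ih _ hlt p i j r h rfl) p' p r' r hij' hij hl' hl

/-- Straightening is compatible with the defining relations of the enveloping algebra. -/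
theorem straighten_swap (b : Module.Basis ι R L) (f : List ι → R) (p r : List ι) (i j : ι) :
    straighten b f (p ++ i :: j :: r) = straighten b f (p ++ j :: i :: r) +
      wordForm b (straighten b f) p r ⁅b i, b j⁆ := by
  rcases lt_trichotomy i j with h | rfl | h
  · rw [straighten_descent b f _ p j i r h rfl, ← lie_skew (b i) (b j), map_neg]
    simp
  · simp
  · exact straighten_descent b f _ p i j r h rfl

/-- If the letters of `s` come last and span a subalgebra, then straightening kills the words
that end in `s` as soon as it kills the sorted ones. -/
theorem straighten_append_singleton_eq_zero (b : Module.Basis ι R L) (f : List ι → R) (s : Set ι)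
    (hs : IsUpperSet s) (hlie : ∀ i ∈ s, ∀ j ∈ s, ⁅b i, b j⁆ ∈ Submodule.span R (b '' s))
    (hf : ∀ p, ∀ i ∈ s, f (p ++ [i]) = 0) (l : List ι) :
    ∀ p, ∀ i ∈ s, l = p ++ [i] → straighten b f (p ++ [i]) = 0 := by
  induction l using (InvImage.wf (inversionRank (ι := ι)) wellFounded_lt).induction with
  | _ l ih =>
  rintro p h hh rfl
  by_cases hd : HasDescent (p ++ [h])
  · obtain ⟨q, i, j, r, hij, hl, e⟩ := exists_straighten_eq b f hd
    have key : ∀ m, ∀ k ∈ s, inversionRank (m ++ [k]) < inversionRank (p ++ [h]) →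
        straighten b f (m ++ [k]) = 0 := fun m k hk hlt => ih _ hlt m k hk rfl
    rw [e]
    rcases List.eq_nil_or_concat r with rfl | ⟨r, k, rfl⟩
    · have hj : h = j := by
        have := congrArg List.getLast? hl
        simpa using this
      subst hj
      have hi : i ∈ s := hs hij.le hh
      have h1 := key (q ++ [h]) i hi (by
        rw [hl]; simpa using inversionRank_swap_lt q [] hij)
      have h2 : Submodule.span R (b '' s) ≤
          LinearMap.ker (wordForm b (straighten b f) q []) := by
        rw [Submodule.span_le]
        rintro _ ⟨k, hk, rfl⟩
        have := key q k hk (inversionRank_lt_of_length_lt (by rw [hl]; simp))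
        simpa using this
      have h3 := h2 (hlie i hi h hh)
      rw [LinearMap.mem_ker] at h3
      rw [h3]
      simpa using h1
    · have hk : h = k := by
        have := congrArg List.getLast? hl
        simpa [List.getLast?_append, List.getLast?_cons] using this
      subst hk
      have h1 := key (q ++ j :: i :: r) h hh (by
        rw [hl]; simpa using inversionRank_swap_lt q (r ++ [h]) hij)
      have h2 : wordForm b (straighten b f) q (r ++ [h]) = 0 := by
        refine b.ext fun k => ?_
        have := key (q ++ k :: r) h hh (inversionRank_lt_of_length_lt (by rw [hl]; simp))
        simpa using this
      simp only [List.concat_eq_append, h2]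
      simpa using h1
  · rw [straighten_of_not_hasDescent b f hd, hf p h hh]

end PoincareBirkhoffWitt

section CoinducedModule

variable {R L ι : Type*} [CommRing R] [LieRing L] [LieAlgebra R L]

/-- The functions on words that respect the relations of the enveloping algebra and are killed by
all letters of large degree on the right. -/
def restrictedForms (b : Module.Basis ι R L) (deg : ι → ℤ) : Submodule R (List ι → R) where
  carrier := {G | (∀ p r i j, G (p ++ i :: j :: r) = G (p ++ j :: i :: r) +
      wordForm b G p r ⁅b i, b j⁆) ∧ ∃ s : ℤ, ∀ i, s ≤ deg i → ∀ p, G (p ++ [i]) = 0}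
  zero_mem' := by
    refine ⟨fun p r i j => ?_, 0, fun i _ p => rfl⟩
    have : wordForm b (0 : List ι → R) p r = 0 := b.ext fun k => by simp
    simp [this]
  add_mem' := by
    rintro G G' ⟨h, s, hs⟩ ⟨h', s', hs'⟩
    refine ⟨fun p r i j => ?_, max s s', fun i hi p => ?_⟩
    · have : wordForm b (G + G') p r = wordForm b G p r + wordForm b G' p r :=
        b.ext fun k => by simp
      rw [this, Pi.add_apply, Pi.add_apply, h, h', LinearMap.add_apply]
      ring
    · rw [Pi.add_apply, hs i (le_of_max_le_left hi), hs' i (le_of_max_le_right hi), add_zero]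
  smul_mem' := by
    rintro c G ⟨h, s, hs⟩
    refine ⟨fun p r i j => ?_, s, fun i hi p => ?_⟩
    · have : wordForm b (c • G) p r = c • wordForm b G p r := b.ext fun k => by simp
      rw [this, Pi.smul_apply, Pi.smul_apply, h, LinearMap.smul_apply, smul_add]
    · rw [Pi.smul_apply, hs i hi, smul_zero]

/-- Right translation of functions on words, as a linear map in the letter and the function. -/
noncomputable def wordTranslation (b : Module.Basis ι R L) :
    L →ₗ[R] (List ι → R) →ₗ[R] (List ι → R) :=
  b.constr R fun i => LinearMap.funLeft R R fun p => p ++ [i]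

@[simp]
theorem wordTranslation_basis (b : Module.Basis ι R L) (i : ι) (G : List ι → R) (p : List ι) :
    wordTranslation b (b i) G p = G (p ++ [i]) := by
  simp [wordTranslation, LinearMap.funLeft_apply]

theorem wordTranslation_apply (b : Module.Basis ι R L) (x : L) (G : List ι → R) (p : List ι) :
    wordTranslation b x G p = wordForm b G p [] x := by
  have : LinearMap.proj p ∘ₗ (wordTranslation b).flip G = wordForm b G p [] :=
    b.ext fun k => by simp
  rw [← this]
  rfl

theorem wordTranslation_mem (b : Module.Basis ι R L) (deg : ι → ℤ)
    (hdeg : ∀ i j, ⁅b i, b j⁆ ∈ Submodule.span R (b '' {k | deg k = deg i + deg j}))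
    (x : L) {G : List ι → R} (hG : G ∈ restrictedForms b deg) :
    wordTranslation b x G ∈ restrictedForms b deg := by
  have key : ⊤ ≤ (restrictedForms b deg).comap ((wordTranslation b).flip G) := by
    rw [← b.span_eq, Submodule.span_le]
    rintro _ ⟨k, rfl⟩
    obtain ⟨h, s, hs⟩ := hG
    refine ⟨fun p r i j => ?_, max s (s - deg k), fun i hi p => ?_⟩
    · have : wordForm b (wordTranslation b (b k) G) p r = wordForm b G p (r ++ [k]) :=
        b.ext fun m => by simp
      simpa [this] using h p (r ++ [k]) i j
    · have h0 : Submodule.span R (b '' {m | deg m = deg i + deg k}) ≤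
          LinearMap.ker (wordForm b G p []) := by
        rw [Submodule.span_le]
        rintro _ ⟨m, hm, rfl⟩
        have hm' : deg m = deg i + deg k := hm
        simpa using hs m (by have := le_of_max_le_right hi; omega) p
      have h1 := h0 (hdeg i k)
      rw [LinearMap.mem_ker] at h1
      have h2 := h p [] i k
      have h3 := hs i (le_of_max_le_left hi) (p ++ [k])
      simp only [List.append_assoc, List.singleton_append] at h3
      simpa [h1, h3] using h2
  exact key (Submodule.mem_top (x := x))

theorem wordTranslation_lie (b : Module.Basis ι R L) (deg : ι → ℤ) (x y : L) {G : List ι → R}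
    (hG : G ∈ restrictedForms b deg) :
    wordTranslation b ⁅x, y⁆ G =
      wordTranslation b x (wordTranslation b y G) -
        wordTranslation b y (wordTranslation b x G) := by
  funext p
  let T := wordTranslation b
  let E : L →ₗ[R] L →ₗ[R] R :=
    (LieModule.toEnd R L L : L →ₗ[R] Module.End R L).compr₂ (LinearMap.proj p ∘ₗ T.flip G)
  let C : L →ₗ[R] L →ₗ[R] R := (T.compl₂ (T.flip G)).compr₂ (LinearMap.proj p)
  have : E = C - C.flip := by
    refine b.ext fun i => b.ext fun j => ?_
    have h := hG.1 p [] i j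
    simpa [E, C, T, wordTranslation_apply, eq_sub_iff_add_eq, add_comm] using h.symm
  exact LinearMap.congr_fun (LinearMap.congr_fun this x) y

end CoinducedModule

theorem stmt0
    (P : Type) [LieRing P] [LieAlgebra ℂ P]
    (g : ℤ → Submodule ℂ P)
    (hdecomp : DirectSum.IsInternal g)
    (hgrade : ∀ m n : ℤ, ∀ x ∈ g m, ∀ y ∈ g n, ⁅x, y⁆ ∈ g (m + n))
    (a : P)
    (ha : ∀ (W : Type) [AddCommGroup W] [Module ℂ W] [LieRingModule P W]
        [LieModule ℂ P W],
        (∀ w : W, ∃ s : ℤ, 0 < s ∧ ∀ n ≥ s, ∀ x ∈ g n, ⁅x, w⁆ = 0) →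
        ∀ w : W, ⁅a, w⁆ = 0) :
    a = 0 := by
  classical
  let κ : ℤ → Type := fun n => Module.Basis.ofVectorSpaceIndex ℂ (g n)
  let (n : ℤ) : LinearOrder (κ n) := IsWellOrder.linearOrder WellOrderingRel
  let ι : Type := Σₗ n, κ n
  let b : Module.Basis ι ℂ P :=
    (hdecomp.collectedBasis fun n => Module.Basis.ofVectorSpace ℂ (g n)).reindex toLex
  let deg : ι → ℤ := fun i => (ofLex i).1
  have hmono : Monotone deg := by
    intro i j hij
    rcases Sigma.Lex.le_def.1 hij with h | ⟨h, _⟩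
    · exact h.le
    · exact h.le
  have hb : ∀ i, b i ∈ g (deg i) := fun i => by
    simp only [b, Module.Basis.reindex_apply]
    exact hdecomp.collectedBasis_mem _ _
  have hspan : ∀ n, ∀ x ∈ g n, x ∈ Submodule.span ℂ (b '' {k | deg k = n}) := by
    intro n x hx
    have h1 : (⟨x, hx⟩ : g n) ∈ Submodule.span ℂ
        (Set.range (Module.Basis.ofVectorSpace ℂ (g n))) := by
      rw [Module.Basis.span_eq]; trivial
    have h2 := Submodule.mem_map_of_mem (f := (g n).subtype) h1
    rw [Submodule.map_span] at h2
    refine Submodule.span_mono ?_ h2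
    rintro _ ⟨_, ⟨k, rfl⟩, rfl⟩
    refine ⟨toLex ⟨n, k⟩, rfl, ?_⟩
    simp [b]
    rfl
  have hlie : ∀ i j, ⁅b i, b j⁆ ∈ Submodule.span ℂ (b '' {k | deg k = deg i + deg j}) :=
    fun i j => hspan _ _ (hgrade _ _ _ (hb i) _ (hb j))
  let W := restrictedForms b deg
  let : LieRingModule P W :=
    { bracket := fun x w => ⟨wordTranslation b x w, wordTranslation_mem b deg hlie x w.2⟩
      add_lie := fun x y w => Subtype.ext (by
        change wordTranslation b (x + y) w = wordTranslation b x w + wordTranslation b y w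
        simp)
      lie_add := fun x v w => Subtype.ext (map_add (wordTranslation b x) _ _)
      leibniz_lie := fun x y w => Subtype.ext (by
        change wordTranslation b x (wordTranslation b y w) =
          wordTranslation b ⁅x, y⁆ w + wordTranslation b y (wordTranslation b x w)
        rw [wordTranslation_lie b deg x y w.2, sub_add_cancel]) }
  let : LieModule ℂ P W :=
    { smul_lie := fun c x w => Subtype.ext (by
        change wordTranslation b (c • x) w = c • wordTranslation b x w
        simp)
      lie_smul := fun c x w => Subtype.ext (map_smul (wordTranslation b x) _ _) }
  have hact : ∀ w : W, wordTranslation b a w = 0 := by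
    refine fun w => congrArg Subtype.val (ha W ?_ w)
    intro w
    obtain ⟨-, s, hs⟩ := w.2
    refine ⟨max s 1, by positivity, fun n hn x hx => Subtype.ext ?_⟩
    change wordTranslation b x w = 0
    funext p
    rw [wordTranslation_apply]
    have h0 : Submodule.span ℂ (b '' {k | deg k = n}) ≤
        LinearMap.ker (wordForm b (w : List ι → ℂ) p []) := by
      rw [Submodule.span_le]
      rintro _ ⟨m, hm, rfl⟩
      have hm' : deg m = n := hm
      simpa using hs m (hm' ▸ le_of_max_le_left hn) p
    exact h0 (hspan n x hx)
  refine b.ext_elem fun i₀ => ?_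
  let f : List ι → ℂ := fun l => if l = [i₀] then 1 else 0
  let s : ℤ := max 0 (deg i₀ + 1)
  have hzero := straighten_append_singleton_eq_zero b f {i | s ≤ deg i}
    (fun i j hij hi => le_trans hi (hmono hij))
    (fun i hi j hj => by
      refine Submodule.span_mono (Set.image_mono ?_) (hlie i j)
      intro k hk
      have h1 : s ≤ deg i := hi
      have h2 : s ≤ deg j := hj
      have h3 : deg k = deg i + deg j := hk
      have h4 : 0 ≤ s := le_max_left _ _
      change s ≤ deg k
      omega)
    (fun p i hi => by
      refine if_neg fun h => ?_
      have hii : i = i₀ := by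
        have := congrArg List.getLast? h
        simpa using this
      have h1 : s ≤ deg i := hi
      have h2 : deg i₀ + 1 ≤ s := le_max_right _ _
      subst hii
      omega)
  have hmem : straighten b f ∈ restrictedForms b deg :=
    ⟨fun p r i j => straighten_swap b f p r i j, s, fun i hi p => hzero _ p i hi rfl⟩
  have hsingle : ∀ i, straighten b f [i] = f [i] := fun i => by
    refine straighten_of_not_hasDescent b f ?_
    rintro ⟨d, -, hd⟩
    have := congrArg List.length hd
    simp at this
    omega
  have hform : wordForm b (straighten b f) [] [] = b.coord i₀ :=
    b.ext fun k => by
      simp [hsingle, f, Finsupp.single_apply]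
  have h := congrFun (hact ⟨_, hmem⟩) []
  rw [wordTranslation_apply] at h
  change wordForm b (straighten b f) [] [] a = 0 at h
  rw [hform] at h
  simpa using h
end

section
/- Let A = (a_{ij})_{i,j ∈ I} be an indecomposable generalized Cartan matrix of finite or affine type, let μ be a diagram automorphism of A, and let i ∈ I. Then exactly one of the following holds: (a) a_{pq} = 0 for all p ≠ q in the orbit O(i); (b) μ(i) ≠ i, O(i) = {i, μ(i)}, and a_{i μ(i)} = −1 = a_{μ(i) i}; (c) O(i) = I and A is of type A_{|I|−1}^{(1)}, meaning that either |I| = 2 and both off-diagonal entries of A equal −2, or |I| ≥ 3 and there is a bijection σ : ℤ/|I|ℤ → I such that a_{σ(s)σ(t)} = −1 whenever s − t ≡ ±1 (mod |I|) and a_{σ(s)σ(t)} = 0 whenever s ≠ t and s − t ≢ ±1 (mod |I|). -/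
/-- A generalized Cartan matrix. -/
def IsGCM {I : Type} (A : I → I → ℤ) : Prop :=
  (∀ i, A i i = 2) ∧ (∀ i j, i ≠ j → A i j ≤ 0) ∧ (∀ i j, A i j = 0 ↔ A j i = 0)

/-- Indecomposability: the graph on `I` with an edge between `i` and `j` whenever
`A i j ≠ 0` is connected. -/
def IsIndecomposable {I : Type} (A : I → I → ℤ) : Prop :=
  ∀ i j : I, Relation.ReflTransGen (fun p q => A p q ≠ 0) i j

/-- The principal minor of `A` indexed by a finite subset `S` of `I` (as a rational number). -/
noncomputable def principalMinor {I : Type} [DecidableEq I] (A : I → I → ℤ)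
    (S : Finset I) : ℚ :=
  Matrix.det (fun p q : S => (A p.1 q.1 : ℚ))

/-- `A` is of finite or affine type: every proper principal minor is positive and
`det A ≥ 0`. -/
def IsFinOrAffType {I : Type} [Fintype I] [DecidableEq I] (A : I → I → ℤ) : Prop :=
  (∀ S : Finset I, S ≠ Finset.univ → 0 < principalMinor A S) ∧
    0 ≤ principalMinor A Finset.univ

/-- The orbit of `i` under the cyclic group generated by the permutation `μ`. -/
def permOrbit {I : Type} (μ : Equiv.Perm I) (i : I) : Set I :=
  Set.range fun k : ℕ => (μ ^ k) i

/-- Expansion of the determinant of a matrix whose `i`-th row is `B i + c i • e i`, in terms of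
principal minors. -/
theorem det_add_diagonal_eq_sum {n R : Type*} [Fintype n] [DecidableEq n] [CommRing R]
    (B : Matrix n n R) (c : n → R) :
    (B + Matrix.diagonal c).det =
      ∑ s : Finset n, (∏ i ∈ sᶜ, c i) * (B.submatrix ((↑) : s → n) (↑)).det := by
  have hrow : B + Matrix.diagonal c = fun i => B i + c i • (1 : Matrix n n R) i := by
    ext i j
    by_cases h : i = j <;> simp [h, Matrix.diagonal, Matrix.one_apply]
  have hexp := (Matrix.detRowAlternating (n := n) (R := R)).map_add_univ
    (fun i => B i) (fun i => c i • (1 : Matrix n n R) i)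
  rw [hrow]
  refine hexp.trans (Finset.sum_congr rfl fun s _ => ?_)
  rw [← Matrix.det_piecewise_one_eq_submatrix_det]
  have hsmul : s.piecewise (fun i => B i) (fun i => c i • (1 : Matrix n n R) i) =
      fun i => (if i ∈ s then 1 else c i) • s.piecewise B.row (1 : Matrix n n R).row i := by
    funext i j
    by_cases h : i ∈ s <;> simp [Finset.piecewise, h, Matrix.row]
  rw [hsmul, AlternatingMap.map_smul_univ, smul_eq_mul]
  congr 1
  rw [← Finset.prod_mul_prod_compl s]
  rw [Finset.prod_congr rfl (g := fun _ => (1 : R)) (fun i hi => by simp [hi]),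
    Finset.prod_const_one, one_mul]
  exact Finset.prod_congr rfl fun i hi => by simp [Finset.mem_compl.mp hi]

section FiniteOrAffine

variable {I : Type} {A : I → I → ℤ}

/-- In finite or affine type, a nonempty set of indices on which all row sums are nonpositive is
everything, and then all row sums vanish. -/
theorem IsFinOrAffType.eq_univ_of_rowSum_nonpos [Fintype I] [DecidableEq I] (hA : IsFinOrAffType A) {S : Finset I}
    (hne : S.Nonempty) (hS : ∀ p ∈ S, ∑ q ∈ S, A p q ≤ 0) :
    S = Finset.univ ∧ ∀ p, ∑ q, A p q = 0 := by
  set B : Matrix I I ℚ := Matrix.of fun p q => if p ∈ S then (A p q : ℚ) else 0 with hB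
  set c : I → ℚ := fun p => if p ∈ S then -((∑ q ∈ S, A p q : ℤ) : ℚ) else 1 with hc
  have hc0 : ∀ p, 0 ≤ c p := by
    intro p
    by_cases h : p ∈ S
    · have : ((∑ q ∈ S, A p q : ℤ) : ℚ) ≤ 0 := by exact_mod_cast hS p h
      simp only [hc, h, if_true]
      linarith
    · simp [hc, h]
  have hdet : (B + Matrix.diagonal c).det = 0 := by
    refine Matrix.exists_mulVec_eq_zero_iff.mp ⟨fun p => if p ∈ S then 1 else 0, ?_, ?_⟩
    · obtain ⟨p, hp⟩ := hne
      intro h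
      simpa [hp] using congrFun h p
    · funext p
      rw [Matrix.add_mulVec, Pi.add_apply, Matrix.mulVec_diagonal]
      by_cases h : p ∈ S <;> simp [Matrix.mulVec, dotProduct, hB, hc, h]
  have hminor : ∀ s : Finset I, s ⊆ S →
      (B.submatrix ((↑) : s → I) (↑)).det = principalMinor A s := by
    intro s hs
    unfold principalMinor
    congr 1
    ext p q
    simp [hB, hs p.2]
  have hnonneg : ∀ s ∈ (Finset.univ : Finset (Finset I)),
      0 ≤ (∏ i ∈ sᶜ, c i) * (B.submatrix ((↑) : s → I) (↑)).det := by
    intro s _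
    by_cases hs : s ⊆ S
    · refine mul_nonneg (Finset.prod_nonneg fun i _ => hc0 i) ?_
      rw [hminor s hs]
      by_cases hu : s = Finset.univ
      · exact hu ▸ hA.2
      · exact (hA.1 s hu).le
    · obtain ⟨p, hps, hpS⟩ := Finset.not_subset.mp hs
      rw [Matrix.det_eq_zero_of_row_eq_zero (⟨p, hps⟩ : s) (fun q => by simp [hB, hpS]), mul_zero]
  rw [det_add_diagonal_eq_sum, Finset.sum_eq_zero_iff_of_nonneg hnonneg] at hdet
  have huniv : S = Finset.univ := by
    by_contra hu
    have h := hdet S (Finset.mem_univ _)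
    rw [hminor S subset_rfl,
      Finset.prod_congr rfl (g := fun _ => (1 : ℚ))
        (fun i hi => by simp [hc, Finset.mem_compl.mp hi]), Finset.prod_const_one, one_mul] at h
    exact (hA.1 S hu).ne' h
  subst huniv
  refine ⟨rfl, fun p => ?_⟩
  have h := hdet {p}ᶜ (Finset.mem_univ _)
  rw [hminor _ (Finset.subset_univ _), compl_compl, Finset.prod_singleton] at h
  have hpos := hA.1 ({p}ᶜ : Finset I) (by
    intro h
    have := Finset.mem_univ p
    simp [← h] at this)
  have := (mul_eq_zero.mp h).resolve_right hpos.ne'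
  simp only [hc, Finset.mem_univ, if_true, neg_eq_zero] at this
  exact_mod_cast this

theorem IsGCM.rowSum_le_of_subset [DecidableEq I] (hA : IsGCM A) {S T : Finset I} {p : I} (hp : p ∈ T)
    (hTS : T ⊆ S) : ∑ q ∈ S, A p q ≤ ∑ q ∈ T, A p q := by
  rw [← Finset.sum_sdiff hTS]
  have : ∑ q ∈ S \ T, A p q ≤ 0 := Finset.sum_nonpos fun q hq => hA.2.1 p q (by
    rintro rfl
    exact (Finset.mem_sdiff.mp hq).2 hp)
  linarith

theorem IsGCM.le_neg_one (hA : IsGCM A) {p q : I} (hpq : p ≠ q) (h : A p q ≠ 0) :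
    A p q ≤ -1 := by
  have := hA.2.1 p q hpq
  omega

theorem IsGCM.rowSum_nonpos_of_two_neighbors [DecidableEq I] (hA : IsGCM A) {S : Finset I} {p a b : I}
    (hp : p ∈ S) (ha : a ∈ S) (hb : b ∈ S) (hpa : p ≠ a) (hpb : p ≠ b) (hab : a ≠ b)
    (hAa : A p a ≠ 0) (hAb : A p b ≠ 0) : ∑ q ∈ S, A p q ≤ 0 := by
  have h := hA.rowSum_le_of_subset (S := S) (T := {p, a, b}) (p := p) (by simp)
    (by simp [Finset.insert_subset_iff, hp, ha, hb])
  rw [Finset.sum_insert (by simp [hpa, hpb]), Finset.sum_pair hab, hA.1] at h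
  have := hA.le_neg_one hpa hAa
  have := hA.le_neg_one hpb hAb
  omega

theorem IsGCM.entries_of_two_neighbors [Fintype I] [DecidableEq I] (hA : IsGCM A) {p a b : I} (hsum : ∑ q, A p q = 0)
    (hpa : p ≠ a) (hpb : p ≠ b) (hab : a ≠ b) (hAa : A p a ≠ 0) (hAb : A p b ≠ 0) :
    A p a = -1 ∧ A p b = -1 ∧ ∀ c, p ≠ c → A p c ≠ 0 → c = a ∨ c = b := by
  have ha := hA.le_neg_one hpa hAa
  have hb := hA.le_neg_one hpb hAb
  have h := hA.rowSum_le_of_subset (S := Finset.univ) (T := {p, a, b}) (p := p) (by simp)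
    (Finset.subset_univ _)
  rw [Finset.sum_insert (by simp [hpa, hpb]), Finset.sum_pair hab, hA.1, hsum] at h
  refine ⟨by omega, by omega, fun c hpc hAc => ?_⟩
  by_contra! hc
  have h := hA.rowSum_le_of_subset (S := Finset.univ) (T := {p, c, a, b}) (p := p) (by simp)
    (Finset.subset_univ _)
  rw [Finset.sum_insert (by simp [hpa, hpb, hpc]), Finset.sum_insert (by simp [hc]),
    Finset.sum_pair hab, hA.1, hsum] at h
  have := hA.le_neg_one hpc hAc
  omega

theorem IsGCM.rowSum_nonpos_of_le_neg_two [DecidableEq I] (hA : IsGCM A) {S : Finset I} {p a : I}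
    (hp : p ∈ S) (ha : a ∈ S) (hpa : p ≠ a) (hAa : A p a ≤ -2) : ∑ q ∈ S, A p q ≤ 0 := by
  have h := hA.rowSum_le_of_subset (S := S) (T := {p, a}) (p := p) (by simp)
    (by simp [Finset.insert_subset_iff, hp, ha])
  rw [Finset.sum_pair hpa, hA.1] at h
  omega

theorem IsGCM.entries_of_le_neg_two [Fintype I] [DecidableEq I] (hA : IsGCM A) {p a : I} (hsum : ∑ q, A p q = 0)
    (hpa : p ≠ a) (hAa : A p a ≤ -2) : A p a = -2 := by
  have h := hA.rowSum_le_of_subset (S := Finset.univ) (T := {p, a}) (p := p) (by simp)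
    (Finset.subset_univ _)
  rw [Finset.sum_pair hpa, hA.1, hsum] at h
  omega

theorem mem_permOrbit_iff_sameCycle [Finite I] {μ : Equiv.Perm I} {i p : I} :
    p ∈ permOrbit μ i ↔ μ.SameCycle i p := by
  constructor
  · rintro ⟨k, rfl⟩
    exact ⟨k, by simp⟩
  · intro h
    obtain ⟨k, hk⟩ := h.exists_nat_pow_eq
    exact ⟨k, hk⟩

theorem Equiv.Perm.SameCycle.eq_or_eq_of_apply_apply {α : Type*} [Finite α] {f : Equiv.Perm α}
    {x y : α} (h : f.SameCycle x y) (hx : f (f x) = x) : y = x ∨ y = f x := by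
  obtain ⟨k, rfl⟩ := h.exists_nat_pow_eq
  induction k with
  | zero => simp
  | succ k ih =>
    rw [pow_succ', Equiv.Perm.mul_apply]
    rcases ih ⟨k, by simp⟩ with ih | ih <;> simp [ih, hx]

/-- If `c` and `f m` are the neighbours of `f 0`, while `f (m - 1)` and `κ c` are those of `f m`
and all vertices have at most two neighbours, then an automorphism `κ` with `κ (f 0) = f m`
reverses the path `f`. -/
theorem apply_path_eq_reverse {κ : Equiv.Perm I} (hκ : ∀ p q, A (κ p) (κ q) = A p q)
    {f : ℕ → I} {m : ℕ} {c : I} (hm : 0 < m)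
    (hinj : ∀ k ≤ m, ∀ l ≤ m, f k = f l → k = l)
    (hadj : ∀ k < m, A (f k) (f (k + 1)) ≠ 0)
    (hsymm : ∀ p q, A p q = 0 ↔ A q p = 0)
    (htwo : ∀ p a b d, p ≠ a → p ≠ b → a ≠ b → p ≠ d → A p a ≠ 0 → A p b ≠ 0 → A p d ≠ 0 →
      d = a ∨ d = b)
    (hc0 : f 1 ≠ c) (hcm : A (f m) (κ c) ≠ 0) (hcm' : f m ≠ κ c) (hc' : f (m - 1) ≠ κ c)
    (h0 : κ (f 0) = f m) : ∀ l ≤ m, κ (f l) = f (m - l) := by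
  have hne : ∀ k ≤ m, ∀ l ≤ m, k ≠ l → f k ≠ f l := fun k hk l hl hkl h => hkl (hinj k hk l hl h)
  have hpred : ∀ k < m, A (f (k + 1)) (f k) ≠ 0 := fun k hk h => hadj k hk ((hsymm _ _).mpr h)
  intro l
  induction l using Nat.strong_induction_on with
  | _ l ih =>
    intro hl
    match l with
    | 0 => simpa using h0
    | 1 =>
      have h1 : A (f m) (κ (f 1)) ≠ 0 := by
        rw [← h0, hκ]
        exact hadj 0 hm
      have h2 : A (f m) (f (m - 1)) ≠ 0 := by
        have := hpred (m - 1) (by omega)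
        rwa [Nat.sub_add_cancel hm] at this
      have h3 : f m ≠ κ (f 1) := by
        rw [← h0]
        exact fun h => hne 0 (by omega) 1 hl (by omega) (κ.injective h)
      refine (htwo (f m) _ _ _ (hne m le_rfl (m - 1) (by omega) (by omega)) hcm' hc' h3 h2 hcm
        h1).resolve_right fun h => hc0 (κ.injective h)
    | l + 2 =>
      have e0 := ih l (by omega) (by omega)
      have e1 := ih (l + 1) (by omega) (by omega)
      have h1 : A (f (m - (l + 1))) (κ (f (l + 2))) ≠ 0 := by
        rw [← e1, hκ]
        exact hadj (l + 1) (by omega)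
      have h2 : A (f (m - (l + 1))) (f (m - l)) ≠ 0 := by
        have := hadj (m - (l + 1)) (by omega)
        rwa [show m - (l + 1) + 1 = m - l by omega] at this
      have h3 : A (f (m - (l + 1))) (f (m - (l + 2))) ≠ 0 := by
        have := hpred (m - (l + 2)) (by omega)
        rwa [show m - (l + 2) + 1 = m - (l + 1) by omega] at this
      have h4 : f (m - (l + 1)) ≠ κ (f (l + 2)) := by
        rw [← e1]
        exact fun h => hne (l + 1) (by omega) (l + 2) hl (by omega) (κ.injective h)
      refine (htwo _ _ _ _ (hne _ (by omega) _ (by omega) (by omega))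
        (hne _ (by omega) _ (by omega) (by omega)) (hne _ (by omega) _ (by omega) (by omega))
        h4 h2 h3 h1).resolve_left fun h => ?_
      rw [← e0] at h
      exact hne (l + 2) hl l (by omega) (by omega) (κ.injective h)

/-- The graph underlying a generalized Cartan matrix. -/
def IsGCM.graph (hA : IsGCM A) : SimpleGraph I where
  Adj p q := p ≠ q ∧ A p q ≠ 0
  symm := ⟨fun p q h => ⟨h.1.symm, fun h0 => h.2 ((hA.2.2 p q).mpr h0)⟩⟩
  loopless := ⟨fun _ h => h.1 rfl⟩

theorem IsGCM.graph_reachable (hA : IsGCM A) (hInd : IsIndecomposable A) (p q : I) :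
    hA.graph.Reachable p q := by
  induction hInd p q with
  | refl => exact SimpleGraph.Reachable.refl _
  | @tail b c _ hbc ih =>
    by_cases h : b = c
    · exact h ▸ ih
    · exact ih.trans (SimpleGraph.Adj.reachable (G := hA.graph) ⟨h, hbc⟩)

theorem apply_pow_apply_pow {μ : Equiv.Perm I} (hμ : ∀ i j, A (μ i) (μ j) = A i j) (k : ℕ)
    (p q : I) : A ((μ ^ k) p) ((μ ^ k) q) = A p q := by
  induction k with
  | zero => simp
  | succ k ih => rw [pow_succ', Equiv.Perm.mul_apply, Equiv.Perm.mul_apply, hμ, ih]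

/-- If some power of the diagram automorphism `μ` interchanges the adjacent vertices `i` and `j`,
then the orbit of `i` is `{i, j}`. -/
theorem eq_or_eq_of_sameCycle_of_involution [Fintype I] [DecidableEq I] (hA : IsGCM A)
    (hInd : IsIndecomposable A) (hFA : IsFinOrAffType A) {μ : Equiv.Perm I}
    (hμ : ∀ i j, A (μ i) (μ j) = A i j) {i : I} {a : ℕ}
    (hinv : (μ ^ a) ((μ ^ a) i) = i) (hne : i ≠ (μ ^ a) i) (hadj : A i ((μ ^ a) i) ≠ 0)
    {z : I} (hz : μ.SameCycle i z) : z = i ∨ z = (μ ^ a) i := by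
  set ν := μ ^ a with hνdef
  have hν : ∀ p q, A (ν p) (ν q) = A p q := apply_pow_apply_pow hμ a
  have hcomm : ∀ p, ν (μ p) = μ (ν p) := fun p =>
    congrArg (· p) (Commute.pow_self μ a : ν * μ = μ * ν)
  have hO : ∀ p, μ.SameCycle i p → ν (ν p) = p ∧ p ≠ ν p ∧ A p (ν p) ≠ 0 := by
    intro p hp
    obtain ⟨k, rfl⟩ := hp.exists_nat_pow_eq
    have hk : ∀ p, ν ((μ ^ k) p) = (μ ^ k) (ν p) := fun p =>
      congrArg (· p) (Commute.pow_pow_self μ a k : ν * μ ^ k = μ ^ k * ν)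
    simp only [hk, apply_pow_apply_pow hμ]
    exact ⟨by rw [hinv], fun h => hne ((μ ^ k).injective h), hadj⟩
  have hOν : ∀ p, μ.SameCycle i (ν p) ↔ μ.SameCycle i p := fun p =>
    Equiv.Perm.sameCycle_pow_right
  by_contra! hcon
  obtain ⟨⟨x, y⟩, ⟨hx, hy, hyx, hyνx⟩, hmin⟩ := Set.exists_min_image
    {x : I × I | μ.SameCycle i x.1 ∧ μ.SameCycle i x.2 ∧ x.2 ≠ x.1 ∧ x.2 ≠ ν x.1}
    (fun x => hA.graph.dist x.1 x.2) (Set.toFinite _) ⟨(i, z), .refl _ _, hz, hcon.1, hcon.2⟩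
  dsimp only at hx hy hyx hyνx hmin
  obtain ⟨w, hwpath, hwlen⟩ := (hA.graph_reachable hInd x y).exists_path_of_dist
  set f := w.getVert with hf
  set m := w.length with hm
  have hf0 : f 0 = x := w.getVert_zero
  have hfm : f m = y := w.getVert_length
  have hfinj : ∀ k ≤ m, ∀ l ≤ m, f k = f l → k = l := fun k hk l hl h =>
    hwpath.getVert_injOn hk hl h
  have hfne : ∀ k ≤ m, ∀ l ≤ m, k ≠ l → f k ≠ f l := fun k hk l hl hkl h =>
    hkl (hfinj k hk l hl h)
  have hfadj : ∀ k < m, A (f k) (f (k + 1)) ≠ 0 := fun k hk => (w.adj_getVert_succ hk).2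
  have hm0 : 0 < m := by
    rcases Nat.eq_zero_or_pos m with h | h
    · exact absurd (by rw [← hfm, ← hf0, h]) hyx
    · exact h
  have hfpred : ∀ k < m, A (f (k + 1)) (f k) ≠ 0 := fun k hk h =>
    hfadj k hk ((hA.2.2 _ _).mpr h)
  have hinterior : ∀ l, 0 < l → l < m → ¬ μ.SameCycle i (f l) := by
    intro l hl0 hlm hl
    by_cases h : f l ≠ x ∧ f l ≠ ν x
    · have h1 := hmin (x, f l) ⟨hx, hl, h.1, h.2⟩
      have h2 : hA.graph.dist x (f l) ≤ (w.take l).length := SimpleGraph.dist_le (w.take l)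
      rw [SimpleGraph.Walk.take_length] at h2
      dsimp only at h1
      omega
    · have h' : f l = x ∨ f l = ν x := by tauto
      have h1 := hmin (f l, y) ⟨hl, hy, by
        rcases h' with h' | h' <;> rw [h'] <;> assumption, by
        rcases h' with h' | h' <;> rw [h']
        · exact hyνx
        · rwa [(hO x hx).1]⟩
      have h2 : hA.graph.dist (f l) y ≤ (w.drop l).length := SimpleGraph.dist_le (w.drop l)
      rw [SimpleGraph.Walk.drop_length] at h2
      dsimp only at h1
      omega
  have hf1 : f 1 ≠ ν x := by
    intro h
    by_cases hm1 : m = 1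
    · exact hyνx (by rw [← hfm, hm1, h])
    · exact hinterior 1 one_pos (by omega) (by rw [h, hOν]; exact hx)
  have hfm1 : f (m - 1) ≠ ν y := by
    intro h
    by_cases hm1 : m = 1
    · rw [hm1, Nat.sub_self, hf0] at h
      exact hyνx (by rw [h, (hO y hy).1])
    · exact hinterior (m - 1) (by omega) (by omega) (by rw [h, hOν]; exact hy)
  set S : Finset I := (Finset.range (m + 1)).image f ∪ (Finset.range (m + 1)).image (ν ∘ f)
    with hSdef
  have hmemS : ∀ p, p ∈ S ↔ ∃ l ≤ m, p = f l ∨ p = ν (f l) := by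
    intro p
    simp only [hSdef, Finset.mem_union, Finset.mem_image, Finset.mem_range, Function.comp,
      Nat.lt_succ_iff]
    constructor
    · rintro (⟨l, hl, rfl⟩ | ⟨l, hl, rfl⟩)
      exacts [⟨l, hl, Or.inl rfl⟩, ⟨l, hl, Or.inr rfl⟩]
    · rintro ⟨l, hl, rfl | rfl⟩
      exacts [Or.inl ⟨l, hl, rfl⟩, Or.inr ⟨l, hl, rfl⟩]
  have hfS : ∀ l ≤ m, f l ∈ S ∧ ν (f l) ∈ S := fun l hl =>
    ⟨(hmemS _).mpr ⟨l, hl, Or.inl rfl⟩, (hmemS _).mpr ⟨l, hl, Or.inr rfl⟩⟩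
  have hnbr : ∀ l ≤ m, ∃ b c, (b ∈ S ∧ ν b ∈ S) ∧ (c ∈ S ∧ ν c ∈ S) ∧ f l ≠ b ∧ f l ≠ c ∧
      b ≠ c ∧ A (f l) b ≠ 0 ∧ A (f l) c ≠ 0 := by
    intro l hl
    rcases Nat.eq_zero_or_pos l with rfl | hl0
    · refine ⟨f 1, ν x, hfS 1 hm0, ?_, hfne _ hl _ hm0 (by omega), ?_, hf1, hfadj 0 hm0, ?_⟩
      · rw [(hO x hx).1, ← hf0]
        exact (hfS 0 hl).symm
      · rw [hf0]
        exact (hO x hx).2.1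
      · rw [hf0]
        exact (hO x hx).2.2
    · have hprev : A (f l) (f (l - 1)) ≠ 0 := by
        have := hfpred (l - 1) (by omega)
        rwa [Nat.sub_add_cancel hl0] at this
      rcases hl.eq_or_lt with rfl | hlm
      · refine ⟨f (m - 1), ν y, hfS _ (by omega), ?_, hfne _ hl _ (by omega) (by omega), ?_, hfm1,
          hprev, ?_⟩
        · rw [(hO y hy).1, ← hfm]
          exact (hfS m hl).symm
        · rw [hfm]
          exact (hO y hy).2.1
        · rw [hfm]
          exact (hO y hy).2.2
      · exact ⟨f (l - 1), f (l + 1), hfS _ (by omega), hfS _ hlm,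
          hfne _ hl _ (by omega) (by omega), hfne _ hl _ hlm (by omega),
          hfne _ (by omega) _ hlm (by omega), hprev, hfadj l hlm⟩
  have hnbrS : ∀ p ∈ S, ∃ b ∈ S, ∃ c ∈ S, p ≠ b ∧ p ≠ c ∧ b ≠ c ∧ A p b ≠ 0 ∧ A p c ≠ 0 := by
    intro p hp
    obtain ⟨l, hl, rfl | rfl⟩ := (hmemS p).mp hp <;>
      obtain ⟨b, c, hb, hc, h1, h2, h3, h4, h5⟩ := hnbr l hl
    · exact ⟨b, hb.1, c, hc.1, h1, h2, h3, h4, h5⟩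
    · exact ⟨ν b, hb.2, ν c, hc.2, ν.injective.ne h1, ν.injective.ne h2, ν.injective.ne h3,
        by rwa [hν], by rwa [hν]⟩
  obtain ⟨hSuniv, hsum⟩ := hFA.eq_univ_of_rowSum_nonpos (S := S) ⟨f 0, (hfS 0 (by omega)).1⟩
    fun p hp => by
      obtain ⟨b, hb, c, hc, h1, h2, h3, h4, h5⟩ := hnbrS p hp
      exact hA.rowSum_nonpos_of_two_neighbors hp hb hc h1 h2 h3 h4 h5
  have htwo : ∀ p b c d, p ≠ b → p ≠ c → b ≠ c → p ≠ d → A p b ≠ 0 → A p c ≠ 0 → A p d ≠ 0 →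
      d = b ∨ d = c := fun p b c d h1 h2 h3 h4 h5 h6 h7 =>
    (hA.entries_of_two_neighbors (hsum p) h1 h2 h3 h5 h6).2.2 d h4 h7
  have hxz : ∀ p, μ.SameCycle i p → μ.SameCycle x p := fun p hp => hx.symm.trans hp
  have hμx : μ.SameCycle i (μ x) := Equiv.Perm.sameCycle_apply_right.mpr hx
  have hμμ : μ (μ x) ≠ x := by
    intro h
    have hνx : ν x = μ x :=
      ((hxz _ ((hOν x).mpr hx)).eq_or_eq_of_apply_apply h).resolve_left (hO x hx).2.1.symm
    rcases (hxz y hy).eq_or_eq_of_apply_apply h with h | h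
    · exact hyx h
    · exact hyνx (h.trans hνx.symm)
  obtain ⟨κ, hκ, hκν, hκx, hκκ⟩ : ∃ κ : Equiv.Perm I, (∀ p q, A (κ p) (κ q) = A p q) ∧
      (∀ p, κ (ν p) = ν (κ p)) ∧ κ x = y ∧ κ (κ x) = μ (μ x) := by
    have hcase : μ x = y ∨ μ x = ν y := by
      obtain ⟨l, hl, h⟩ := (hmemS (μ x)).mp (hSuniv ▸ Finset.mem_univ _)
      have hlO : μ.SameCycle i (f l) := by
        rcases h with h | h
        · exact h ▸ hμx
        · exact (hOν _).mp (h ▸ hμx)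
      have hl' : l = 0 ∨ l = m := by
        by_contra! hl'
        exact hinterior l (by omega) (by omega) hlO
      rcases hl' with rfl | rfl
      · rw [hf0] at h
        rcases h with h | h
        · exact absurd (by rw [h, h]) hμμ
        · exact absurd (by rw [h, ← hcomm, h, (hO x hx).1]) hμμ
      · rwa [hfm] at h
    rcases hcase with h | h
    · exact ⟨μ, hμ, fun p => (hcomm p).symm, h, rfl⟩
    · refine ⟨ν * μ, fun p q => by simp [hν, hμ], fun p => by simp [hcomm], ?_, ?_⟩
      · simp [h, (hO y hy).1]
      · simp only [Equiv.Perm.mul_apply]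
        rw [← hcomm (μ x), (hO _ (Equiv.Perm.sameCycle_apply_right.mpr hμx)).1]
  have hrev := apply_path_eq_reverse hκ (f := f) (c := ν x) hm0 hfinj hfadj hA.2.2 htwo hf1
    (by rw [hfm, hκν, hκx]; exact (hO y hy).2.2) (by rw [hfm, hκν, hκx]; exact (hO y hy).2.1)
    (by rw [hκν, hκx]; exact hfm1) (by rw [hf0, hfm, hκx]) m le_rfl
  rw [Nat.sub_self, hfm, hf0, ← hκx, hκκ] at hrev
  exact hμμ hrev

/-- If `μ` is transitive, all row sums vanish and a power of `μ` that is not an involution moves a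
vertex to a neighbour, then the diagram is a cycle with all edges simple. -/
theorem exists_zmod_equiv_of_rowSum_eq_zero [Fintype I] [DecidableEq I] (hA : IsGCM A)
    (hInd : IsIndecomposable A) {μ : Equiv.Perm I} (hμ : ∀ i j, A (μ i) (μ j) = A i j) {i : I}
    (hsum : ∀ p, ∑ q, A p q = 0) (htrans : ∀ p, μ.SameCycle i p) {a : ℕ}
    (hinv : (μ ^ a) ((μ ^ a) i) ≠ i) (hne : i ≠ (μ ^ a) i) (hadj : A i ((μ ^ a) i) ≠ 0) :
    3 ≤ Fintype.card I ∧ ∃ σ : ZMod (Fintype.card I) ≃ I,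
      (∀ s t : ZMod (Fintype.card I), (s - t = 1 ∨ s - t = -1) → A (σ s) (σ t) = -1) ∧
      (∀ s t : ZMod (Fintype.card I),
        s ≠ t → s - t ≠ 1 → s - t ≠ -1 → A (σ s) (σ t) = 0) := by
  set ν := μ ^ a with hνdef
  have hν : ∀ p q, A (ν p) (ν q) = A p q := apply_pow_apply_pow hμ a
  have hO : ∀ p, ν (ν p) ≠ p ∧ p ≠ ν p ∧ A p (ν p) ≠ 0 := by
    intro p
    obtain ⟨k, rfl⟩ := (htrans p).exists_nat_pow_eq
    have hk : ∀ p, ν ((μ ^ k) p) = (μ ^ k) (ν p) := fun p =>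
      congrArg (· p) (Commute.pow_pow_self μ a k : ν * μ ^ k = μ ^ k * ν)
    simp only [hk, apply_pow_apply_pow hμ]
    exact ⟨fun h => hinv ((μ ^ k).injective h), fun h => hne ((μ ^ k).injective h), hadj⟩
  have hnbr : ∀ p, A (ν p) (ν (ν p)) = -1 ∧ A (ν p) p = -1 ∧
      ∀ c, ν p ≠ c → A (ν p) c ≠ 0 → c = ν (ν p) ∨ c = p := fun p =>
    hA.entries_of_two_neighbors (hsum (ν p)) (hO (ν p)).2.1 (hO p).2.1.symm (hO p).1
      (hO (ν p)).2.2 fun h => (hO p).2.2 ((hA.2.2 _ _).mpr h)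
  have hνcycle : ∀ p, ν.SameCycle i p := by
    intro p
    induction hInd i p with
    | refl => exact .refl _ _
    | @tail b c _ hbc ih =>
      by_cases h : b = c
      · exact h ▸ ih
      · obtain ⟨b, rfl⟩ := ν.surjective b
        rcases (hnbr b).2.2 c h hbc with rfl | rfl
        · exact Equiv.Perm.sameCycle_apply_right.mpr ih
        · exact Equiv.Perm.sameCycle_apply_right.mp ih
  have hcycle : ν.IsCycleOn ((Finset.univ : Finset I) : Set I) :=
    ⟨by simp, fun p _ q _ => (hνcycle p).symm.trans (hνcycle q)⟩
  have hcard : 3 ≤ Fintype.card I := by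
    have h3 : ({i, ν i, ν (ν i)} : Finset I).card = 3 :=
      Finset.card_eq_three.mpr ⟨_, _, _, hne, hinv.symm, (hO (ν i)).2.1, rfl⟩
    exact h3 ▸ Finset.card_le_univ _
  have : NeZero (Fintype.card I) := ⟨by omega⟩
  have hpow : ∀ k l : ℕ, (ν ^ k) i = (ν ^ l) i ↔ (k : ZMod (Fintype.card I)) = l := fun k l => by
    rw [hcycle.pow_apply_eq_pow_apply (Finset.mem_univ i), ZMod.natCast_eq_natCast_iff,
      Finset.card_univ]
  have hinj : Function.Injective fun s : ZMod (Fintype.card I) => (ν ^ s.val) i := by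
    intro s t h
    simpa using (hpow _ _).mp h
  let σ : ZMod (Fintype.card I) ≃ I := Equiv.ofBijective (fun s => (ν ^ s.val) i)
    ((Fintype.bijective_iff_injective_and_card _).mpr ⟨hinj, ZMod.card _⟩)
  have hσ : ∀ s, σ (s + 1) = ν (σ s) := by
    intro s
    change (ν ^ (s + 1).val) i = ν ((ν ^ s.val) i)
    rw [← Equiv.Perm.mul_apply, ← pow_succ', hpow]
    simp
  refine ⟨hcard, σ, ?_, ?_⟩
  · rintro s t (h | h)
    · obtain rfl : s = t + 1 := by rw [← h]; ring
      rw [hσ]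
      exact (hnbr _).2.1
    · obtain rfl : t = s + 1 := by linear_combination -h
      rw [hσ, ← hν]
      exact (hnbr _).1
  · intro s t hst h1 h2
    by_contra h
    obtain ⟨r, rfl⟩ : ∃ r, s = r + 1 := ⟨s - 1, by ring⟩
    rw [hσ] at h
    rcases (hnbr _).2.2 _ (by rw [← hσ]; exact σ.injective.ne hst) h with h | h
    · rw [← hσ, ← hσ] at h
      exact h2 (by rw [σ.injective h]; ring)
    · exact h1 (by rw [σ.injective h]; ring)

/-- If two distinct vertices of an orbit are adjacent, then the orbit is an edge `-1, -1`, or it is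
the whole diagram, which is an affine cycle. -/
theorem orbit_dichotomy [Fintype I] [DecidableEq I] (hA : IsGCM A)
    (hInd : IsIndecomposable A) (hFA : IsFinOrAffType A) {μ : Equiv.Perm I}
    (hμ : ∀ i j, A (μ i) (μ j) = A i j) {i p q : I} (hp : μ.SameCycle i p)
    (hq : μ.SameCycle i q) (hpq : p ≠ q) (hApq : A p q ≠ 0) :
    (μ i ≠ i ∧ (∀ z, μ.SameCycle i z → z = i ∨ z = μ i) ∧ A i (μ i) = -1 ∧ A (μ i) i = -1) ∨
    ((∀ z, μ.SameCycle i z) ∧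
      ((Fintype.card I = 2 ∧ ∀ p q, p ≠ q → A p q = -2) ∨
        (3 ≤ Fintype.card I ∧ ∃ σ : ZMod (Fintype.card I) ≃ I,
          (∀ s t : ZMod (Fintype.card I), (s - t = 1 ∨ s - t = -1) →
            A (σ s) (σ t) = -1) ∧
          (∀ s t : ZMod (Fintype.card I),
            s ≠ t → s - t ≠ 1 → s - t ≠ -1 → A (σ s) (σ t) = 0)))) := by
  classical
  obtain ⟨a, hne, hadj⟩ : ∃ a : ℕ, i ≠ (μ ^ a) i ∧ A i ((μ ^ a) i) ≠ 0 := by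
    obtain ⟨k, rfl⟩ := hp.exists_nat_pow_eq
    obtain ⟨a, ha⟩ := (hp.symm.trans hq).exists_nat_pow_eq
    have hcomm : (μ ^ a) ((μ ^ k) i) = (μ ^ k) ((μ ^ a) i) :=
      congrArg (· i) (Commute.pow_pow_self μ a k : μ ^ a * μ ^ k = μ ^ k * μ ^ a)
    rw [← ha, hcomm] at hpq hApq
    rw [apply_pow_apply_pow hμ] at hApq
    exact ⟨a, fun h => hpq (congrArg _ h), hApq⟩
  set O : Finset I := Finset.univ.filter fun p => μ.SameCycle i p with hOdef
  have hmemO : ∀ p, p ∈ O ↔ μ.SameCycle i p := fun p => by simp [hOdef]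
  have hνO : ∀ p (k : ℕ), (μ ^ k) p ∈ O ↔ p ∈ O := fun p k => by
    rw [hmemO, hmemO, Equiv.Perm.sameCycle_pow_right]
  have hiO : i ∈ O := (hmemO i).mpr (.refl _ _)
  have hsumO : ∀ p ∈ O, ∑ q ∈ O, A p q = ∑ q ∈ O, A i q := by
    intro p hp
    obtain ⟨k, rfl⟩ := ((hmemO p).mp hp).exists_nat_pow_eq
    refine (Finset.sum_bij (fun q _ => (μ ^ k) q) (fun q hq => (hνO q k).mpr hq)
      (fun _ _ _ _ h => (μ ^ k).injective h) (fun q hq => ?_)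
      (fun q _ => (apply_pow_apply_pow hμ k i q).symm)).symm
    obtain ⟨r, rfl⟩ := (μ ^ k).surjective q
    exact ⟨r, (hνO r k).mp hq, rfl⟩
  have hfull : ∑ q ∈ O, A i q ≤ 0 → (∀ z, μ.SameCycle i z) ∧ ∀ p, ∑ q, A p q = 0 := by
    intro h
    obtain ⟨h1, h2⟩ := hFA.eq_univ_of_rowSum_nonpos ⟨i, hiO⟩ fun p hp => (hsumO p hp).trans_le h
    exact ⟨fun z => (hmemO z).mp (h1 ▸ Finset.mem_univ z), h2⟩
  by_cases hinv : (μ ^ a) ((μ ^ a) i) = i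
  · have hpair := fun z (hz : μ.SameCycle i z) =>
      eq_or_eq_of_sameCycle_of_involution hA hInd hFA hμ hinv hne hadj hz
    have hsymm : A ((μ ^ a) i) i = A i ((μ ^ a) i) := by
      conv_lhs => rw [← hinv, apply_pow_apply_pow hμ]
      rw [hinv]
    rcases (hA.le_neg_one hne hadj).eq_or_lt with h1 | h2
    · left
      have hμi : μ i ≠ i := fun h => hne (by
        have : Function.IsFixedPt (μ ^ a) i := by
          rw [Equiv.Perm.coe_pow]
          exact Function.IsFixedPt.iterate h a
        exact this.symm)
      have hμν : μ i = (μ ^ a) i :=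
        (hpair (μ i) (Equiv.Perm.sameCycle_apply_right.mpr (.refl _ _))).resolve_left hμi
      rw [← hμν] at hpair h1 hsymm
      exact ⟨hμi, hpair, h1, hsymm.trans h1⟩
    · right
      obtain ⟨htrans, hsum⟩ := hfull (hA.rowSum_nonpos_of_le_neg_two hiO
        ((hνO i a).mpr hiO) hne (by omega))
      have hval := hA.entries_of_le_neg_two (hsum i) hne (by omega)
      refine ⟨htrans, Or.inl ⟨?_, ?_⟩⟩
      · rw [← Finset.card_univ, Finset.card_eq_two]
        exact ⟨i, _, hne, by ext z; simpa using hpair z (htrans z)⟩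
      · intro p q hpq
        rcases hpair p (htrans p) with rfl | rfl <;>
          rcases hpair q (htrans q) with rfl | rfl
        all_goals first | exact absurd rfl hpq | exact hval | exact hsymm.trans hval
  · right
    obtain ⟨j, hj⟩ := (μ ^ a).surjective i
    have hij : i ≠ j := fun h => hne (h ▸ hj.symm)
    have hAij : A i j ≠ 0 := fun h => hadj (by
      rw [hA.2.2, ← apply_pow_apply_pow hμ a, hj] at h
      exact h)
    obtain ⟨htrans, hsum⟩ := hfull (hA.rowSum_nonpos_of_two_neighbors hiO ((hνO i a).mpr hiO)
      ((hνO j a).mp (hj ▸ hiO)) hne hij (fun h => hinv (by rw [h, hj])) hadj hAij)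
    exact ⟨htrans, Or.inr
      (exists_zmod_equiv_of_rowSum_eq_zero hA hInd hμ hsum htrans hinv hne hadj)⟩

end FiniteOrAffine

/-- trichotomy for the orbit of a vertex under a diagram automorphism of
an indecomposable generalized Cartan matrix of finite or affine type. -/
theorem stmt4 {I : Type} [Fintype I] [DecidableEq I] (A : I → I → ℤ)
    (hGCM : IsGCM A) (hInd : IsIndecomposable A) (hFA : IsFinOrAffType A)
    (μ : Equiv.Perm I) (hμ : ∀ i j, A (μ i) (μ j) = A i j) (i : I) :
    (((∀ p ∈ permOrbit μ i, ∀ q ∈ permOrbit μ i, p ≠ q → A p q = 0)) ∧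
      ¬(μ i ≠ i ∧ permOrbit μ i = {i, μ i} ∧ A i (μ i) = -1 ∧ A (μ i) i = -1) ∧
      ¬(permOrbit μ i = Set.univ ∧
        ((Fintype.card I = 2 ∧ ∀ p q, p ≠ q → A p q = -2) ∨
          (3 ≤ Fintype.card I ∧ ∃ σ : ZMod (Fintype.card I) ≃ I,
            (∀ s t : ZMod (Fintype.card I), (s - t = 1 ∨ s - t = -1) →
              A (σ s) (σ t) = -1) ∧
            (∀ s t : ZMod (Fintype.card I),
              s ≠ t → s - t ≠ 1 → s - t ≠ -1 → A (σ s) (σ t) = 0))))) ∨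
    ((¬(∀ p ∈ permOrbit μ i, ∀ q ∈ permOrbit μ i, p ≠ q → A p q = 0)) ∧
      (μ i ≠ i ∧ permOrbit μ i = {i, μ i} ∧ A i (μ i) = -1 ∧ A (μ i) i = -1) ∧
      ¬(permOrbit μ i = Set.univ ∧
        ((Fintype.card I = 2 ∧ ∀ p q, p ≠ q → A p q = -2) ∨
          (3 ≤ Fintype.card I ∧ ∃ σ : ZMod (Fintype.card I) ≃ I,
            (∀ s t : ZMod (Fintype.card I), (s - t = 1 ∨ s - t = -1) →
              A (σ s) (σ t) = -1) ∧
            (∀ s t : ZMod (Fintype.card I),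
              s ≠ t → s - t ≠ 1 → s - t ≠ -1 → A (σ s) (σ t) = 0))))) ∨
    ((¬(∀ p ∈ permOrbit μ i, ∀ q ∈ permOrbit μ i, p ≠ q → A p q = 0)) ∧
      ¬(μ i ≠ i ∧ permOrbit μ i = {i, μ i} ∧ A i (μ i) = -1 ∧ A (μ i) i = -1) ∧
      (permOrbit μ i = Set.univ ∧
        ((Fintype.card I = 2 ∧ ∀ p q, p ≠ q → A p q = -2) ∨
          (3 ≤ Fintype.card I ∧ ∃ σ : ZMod (Fintype.card I) ≃ I,
            (∀ s t : ZMod (Fintype.card I), (s - t = 1 ∨ s - t = -1) →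
              A (σ s) (σ t) = -1) ∧
            (∀ s t : ZMod (Fintype.card I),
              s ≠ t → s - t ≠ 1 → s - t ≠ -1 → A (σ s) (σ t) = 0))))) := by
  have horbit : ∀ p, p ∈ permOrbit μ i ↔ μ.SameCycle i p := fun p => mem_permOrbit_iff_sameCycle
  have hbc : ∀ h : permOrbit μ i = {i, μ i}, permOrbit μ i = Set.univ → Fintype.card I ≤ 2 := by
    intro h h'
    have : (Finset.univ : Finset I) = {i, μ i} := by
      rw [← Finset.coe_inj]
      simpa [h] using h'.symm
    rw [← Finset.card_univ, this]
    exact Finset.card_le_two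
  by_cases ha : ∀ p ∈ permOrbit μ i, ∀ q ∈ permOrbit μ i, p ≠ q → A p q = 0
  · refine Or.inl ⟨ha, ?_, ?_⟩
    · rintro ⟨hne, -, h, -⟩
      have := ha i (by simp [horbit, Equiv.Perm.SameCycle.refl]) (μ i)
        (by simp [horbit, Equiv.Perm.SameCycle.refl]) hne.symm
      omega
    · rintro ⟨huniv, ⟨hcard, h⟩ | ⟨hcard, σ, h, -⟩⟩
      · have : Nontrivial I := Fintype.one_lt_card_iff_nontrivial.mp (by omega)
        obtain ⟨p, q, hpq⟩ := exists_pair_ne I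
        have h1 := h p q hpq
        have h2 := ha p (huniv ▸ trivial) q (huniv ▸ trivial) hpq
        omega
      · have : Fact (1 < Fintype.card I) := ⟨by omega⟩
        have h1 := h 1 0 (by simp)
        have h2 := ha (σ 1) (huniv ▸ trivial) (σ 0) (huniv ▸ trivial) (by simp)
        omega
  · right
    have hdich := ha
    push Not at hdich
    obtain ⟨p, hp, q, hq, hpq, hApq⟩ := hdich
    rcases orbit_dichotomy hGCM hInd hFA hμ ((horbit p).mp hp) ((horbit q).mp hq) hpq hApq with
      ⟨hne, hpair, h1, h2⟩ | ⟨htrans, hc⟩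
    · have hset : permOrbit μ i = {i, μ i} := by
        ext z
        refine ⟨fun hz => hpair z ((horbit z).mp hz), ?_⟩
        rintro (rfl | rfl) <;> simp [horbit, Equiv.Perm.SameCycle.refl]
      refine Or.inl ⟨ha, ⟨hne, hset, h1, h2⟩, ?_⟩
      rintro ⟨huniv, ⟨-, h⟩ | ⟨hcard, -⟩⟩
      · have := h i (μ i) hne.symm
        omega
      · have := hbc hset huniv
        omega
    · have huniv : permOrbit μ i = Set.univ :=
        Set.eq_univ_of_forall fun z => (horbit z).mpr (htrans z)
      refine Or.inr ⟨ha, ?_, huniv, hc⟩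
      rintro ⟨hne, hset, h1, -⟩
      rcases hc with ⟨-, h⟩ | ⟨hcard, -⟩
      · have := h i (μ i) hne.symm
        omega
      · have := hbc hset huniv
        omega
end

section
/- Let W be a complex vector space, let s and l be positive integers, let f_1, …, f_l ∈ W[[w, w^{−1}]] (i.e., functions ℤ → W), and let (α^{(1)}, n^{(1)}), …, (α^{(l)}, n^{(l)}) be pairwise distinct elements of (ℂ^×)^s × ℕ^s. Then Σ_{k=1}^{l} f_k(w) · δ^{(α^{(k)}, n^{(k)})}(z_1, …, z_s, w) = 0 as a W-valued formal distribution in z_1, …, z_s, w if and only if f_k = 0 for all k = 1, …, l. -/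
/-- The generalized binomial coefficient `C(m,n) = m(m-1)⋯(m-n+1)/n!` as a complex number. -/
noncomputable def genBinom (m : ℤ) (n : ℕ) : ℂ :=
  (∏ t ∈ Finset.range n, ((m : ℂ) - (t : ℂ))) / (n.factorial : ℂ)

/-- The coefficient of `z₁^{a₁} ⋯ z_s^{a_s} w^b` in the product
`f(w) · δ^{(α,n)}(z₁,…,z_s,w)`, where `f(w) = Σ_p f_p w^p` and
`δ^{(α,n)} = Π_i δ^{(α_i,n_i)}(z_i,w)` with
`δ^{(α,n)}(z,w) = Σ_m C(m,n) α^{m-n} w^{m-n} z^{-m-1}`.  In the monomial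
`z₁^{a₁} ⋯ z_s^{a_s}` the `i`-th factor contributes the `w`-power `-a_i - 1 - n_i`, so the
coefficient is `(Π_i C(-a_i-1, n_i) α_i^{-a_i-1-n_i}) • f(b - Σ_i (-a_i-1-n_i))`. -/
noncomputable def prodDeltaCoeff {W : Type} [AddCommGroup W] [Module ℂ W] {s : ℕ}
    (f : ℤ → W) (α : Fin s → ℂˣ) (n : Fin s → ℕ) (a : Fin s → ℤ) (b : ℤ) : W :=
  (∏ t : Fin s, genBinom (-(a t) - 1) (n t) *
      ((α t : ℂ) ^ (-(a t) - 1 - (n t : ℤ)))) •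
    f (b - ∑ t : Fin s, (-(a t) - 1 - (n t : ℤ)))

theorem genBinom_natCast (i n : ℕ) : genBinom (i : ℤ) n = (i.choose n : ℂ) := by
  have h : ∏ t ∈ Finset.range n, (((i : ℤ) : ℂ) - (t : ℂ)) = (i.descFactorial n : ℂ) := by
    rw [← descPochhammer_eval_eq_descFactorial ℂ, descPochhammer_eval_eq_prod_range]
    simp
  rw [genBinom, h, Nat.descFactorial_eq_factorial_mul_choose, Nat.cast_mul,
    mul_div_cancel_left₀ _ (Nat.cast_ne_zero.mpr n.factorial_ne_zero)]

/-- Pairing the coefficients of `P` with those of `δ^{(α,n)}` computes a Hasse derivative. -/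
theorem sum_coeff_mul_genBinom_mul_zpow (P : Polynomial ℂ) (α : ℂˣ) (n : ℕ) :
    ∑ i ∈ P.support, P.coeff i * (genBinom (i : ℤ) n * (α : ℂ) ^ ((i : ℤ) - (n : ℤ))) =
      (P.taylor (α : ℂ)).coeff n := by
  rw [Polynomial.taylor_coeff, Polynomial.hasseDeriv_apply, Polynomial.sum_def,
    Polynomial.eval_finsetSum]
  refine Finset.sum_congr rfl fun i _ => ?_
  rw [Polynomial.eval_monomial, genBinom_natCast]
  rcases lt_or_ge i n with h | h
  · simp [Nat.choose_eq_zero_of_lt h]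
  · rw [← Nat.cast_sub h, zpow_natCast]
    ring

theorem Polynomial.taylor_coeff_X_sub_C_pow_mul {R : Type*} [CommRing R] (a : R) (N n : ℕ)
    (Q : Polynomial R) :
    (((X - C a) ^ N * Q).taylor a).coeff n =
      if N ≤ n then (Q.taylor a).coeff (n - N) else 0 := by
  simp only [coeff_X_pow_mul', taylor_mul, taylor_pow, map_sub, taylor_X, taylor_C,
    add_sub_cancel_right]

/-- Hermite interpolation: a polynomial whose Taylor coefficient is `1` at one prescribed pair
(point, order) and `0` at finitely many others. -/
theorem Polynomial.exists_taylor_coeff_eq_ite {K : Type*} [Field K] [DecidableEq K]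
    (S : Finset (K × ℕ)) (a : K) (d : ℕ) :
    ∃ P : Polynomial K, ∀ j ∈ S,
      (P.taylor j.1).coeff j.2 = if j = (a, d) then 1 else 0 := by
  obtain ⟨N, hN⟩ : ∃ N : ℕ, ∀ j ∈ S, j.2 < N :=
    ⟨S.sup Prod.snd + 1, fun j hj => Nat.lt_succ_of_le (Finset.le_sup (f := Prod.snd) hj)⟩
  let A : Polynomial K := ∏ b ∈ (S.image Prod.fst).erase a, (X - C b) ^ N
  have hcop : IsCoprime ((X - C a) ^ N) A :=
    IsCoprime.prod_right fun b hb => (isCoprime_X_sub_C_of_isUnit_sub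
      (sub_ne_zero.mpr (Finset.ne_of_mem_erase hb).symm).isUnit).pow
  obtain ⟨u, v, huv⟩ := hcop
  refine ⟨(X - C a) ^ d * (v * A), ?_⟩
  rintro ⟨b, m⟩ hj
  have hm : m < N := hN _ hj
  by_cases hb : b = a
  · subst hb
    have hP : (X - C b) ^ d * (v * A) =
        (X - C b) ^ d * 1 - (X - C b) ^ N * ((X - C b) ^ d * u) := by
      rw [← huv]; ring
    rw [hP, map_sub, coeff_sub, taylor_coeff_X_sub_C_pow_mul, taylor_coeff_X_sub_C_pow_mul,
      if_neg hm.not_ge, sub_zero, taylor_one, map_one, coeff_one]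
    simp only [Prod.mk.injEq, true_and]
    grind
  · have hdvd : (X - C b) ^ N ∣ (X - C a) ^ d * (v * A) :=
      ((Finset.dvd_prod_of_mem (fun b => (X - C b) ^ N) (Finset.mem_erase.mpr
        ⟨hb, Finset.mem_image_of_mem Prod.fst hj⟩)).mul_left v).mul_left _
    obtain ⟨Q, hQ⟩ := hdvd
    rw [hQ, taylor_coeff_X_sub_C_pow_mul, if_neg hm.not_ge, if_neg (by simp [hb])]

/-- linear independence of the products `δ^{(α,n)}`: a finite sum
`Σ_k f_k(w) δ^{(α^{(k)},n^{(k)})}(z₁,…,z_s,w)` vanishes iff all the `f_k` vanish,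
provided the pairs `(α^{(k)}, n^{(k)})` are pairwise distinct. -/
theorem stmt6 (W : Type) [AddCommGroup W] [Module ℂ W]
    (s l : ℕ) (hs : 0 < s) (hl : 0 < l)
    (f : Fin l → ℤ → W)
    (α : Fin l → Fin s → ℂˣ) (n : Fin l → Fin s → ℕ)
    (hdist : ∀ k k' : Fin l, (α k, n k) = (α k', n k') → k = k') :
    (∀ (a : Fin s → ℤ) (b : ℤ),
        ∑ k : Fin l, prodDeltaCoeff (f k) (α k) (n k) a b = 0) ↔
      ∀ k, f k = 0 := by
  classical
  refine ⟨fun H k₀ => funext fun q => ?_, fun H a b => by simp [H, prodDeltaCoeff]⟩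
  have hP (t : Fin s) : ∃ P : Polynomial ℂ, ∀ k, (P.taylor (α k t : ℂ)).coeff (n k t) =
      if ((α k t : ℂ), n k t) = ((α k₀ t : ℂ), n k₀ t) then 1 else 0 := by
    obtain ⟨P, hP⟩ := Polynomial.exists_taylor_coeff_eq_ite
      (Finset.univ.image fun k => ((α k t : ℂ), n k t)) (α k₀ t : ℂ) (n k₀ t)
    exact ⟨P, fun k => hP ((α k t : ℂ), n k t)
      (Finset.mem_image.mpr ⟨k, Finset.mem_univ k, rfl⟩)⟩
  choose P hP using hP
  let g (k : Fin l) : W := f k (q - ∑ t, (n k₀ t : ℤ) + ∑ t, (n k t : ℤ))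
  let ψ (k : Fin l) (t : Fin s) (i : ℕ) : ℂ :=
    genBinom (i : ℤ) (n k t) * (α k t : ℂ) ^ ((i : ℤ) - (n k t : ℤ))
  have hψ (m : Fin s → ℕ) : ∑ k, (∏ t, ψ k t (m t)) • g k = 0 := by
    rw [← H (fun t => -(m t : ℤ) - 1) (∑ t, (m t : ℤ) + (q - ∑ t, (n k₀ t : ℤ)))]
    refine Finset.sum_congr rfl fun k _ => ?_
    simp only [prodDeltaCoeff, ψ, g, neg_sub, sub_neg_eq_add, add_sub_cancel_left,
      Finset.sum_sub_distrib]
    congr 2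
    ring
  have hpair (k : Fin l) : ∑ m ∈ Fintype.piFinset fun t => (P t).support,
      ∏ t, (P t).coeff (m t) * ψ k t (m t) = if k = k₀ then 1 else 0 := by
    rw [← Finset.prod_univ_sum (fun t => (P t).support)
      (fun t i => (P t).coeff i * ψ k t i)]
    simp only [ψ, sum_coeff_mul_genBinom_mul_zpow, hP]
    split_ifs with hk
    · simp [hk]
    · obtain ⟨t, ht⟩ : ∃ t, ¬ ((α k t : ℂ), n k t) = ((α k₀ t : ℂ), n k₀ t) := by
        by_contra! h
        simp only [Prod.mk.injEq, Units.val_inj] at h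
        exact hk (hdist _ _ (Prod.ext (funext fun t => (h t).1) (funext fun t => (h t).2)))
      exact Finset.prod_eq_zero (Finset.mem_univ t) (if_neg ht)
  calc f k₀ q = ∑ k, (if k = k₀ then (1 : ℂ) else 0) • g k := by simp [g]
    _ = ∑ m ∈ Fintype.piFinset fun t => (P t).support,
        (∏ t, (P t).coeff (m t)) • ∑ k, (∏ t, ψ k t (m t)) • g k := by
      simp only [← hpair, Finset.sum_smul, Finset.smul_sum, smul_smul, Finset.prod_mul_distrib]
      exact Finset.sum_comm
    _ = 0 := by simp [hψ]
end

section
/- Let W be a complex vector space and let a(z), b(z) ∈ E(W). Suppose there is a polynomial f(z,w) = Π_{k=1}^{l} (z − α_k w)^{r_k}, with pairwise distinct α_1, …, α_l ∈ ℂ^× and positive integers r_k, such that f(z,w) · [a(z), b(w)] = 0 (all coefficients of this formal distribution vanish). Then there exist unique elements c_{k,n}(z) ∈ E(W), for 1 ≤ k ≤ l and 0 ≤ n ≤ r_k − 1, such that [a(z), b(w)] = Σ_{k=1}^{l} Σ_{n=0}^{r_k − 1} c_{k,n}(w) · δ^{(α_k, n)}(z, w). -/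
/-- Membership in `E(W)`: a family of coefficients `a : ℤ → End(W)` (thought of as
`a(z) = Σ_n a_n z^{-n-1}`) is lower truncated on each vector. -/
def IsFieldSeries {W : Type} [AddCommGroup W] [Module ℂ W]
    (a : ℤ → Module.End ℂ W) : Prop :=
  ∀ w : W, ∃ N : ℤ, ∀ m ≥ N, a m w = 0

theorem genBinom_eq_choose (m : ℤ) (n : ℕ) : genBinom m n = ((Ring.choose m n : ℤ) : ℂ) := by
  have h := congrArg (Int.cast : ℤ → ℂ) (Ring.descPochhammer_eq_factorial_smul_choose m n)
  rw [← Polynomial.eval_eq_smeval, descPochhammer_eval_eq_prod_range] at h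
  push_cast [nsmul_eq_mul] at h
  rw [genBinom, h, mul_div_cancel_left₀ _ (by exact_mod_cast n.factorial_ne_zero)]

theorem genBinom_zero_right (m : ℤ) : genBinom m 0 = 1 := by
  simp [genBinom]

theorem genBinom_succ_succ (m : ℤ) (n : ℕ) :
    genBinom (m + 1) (n + 1) = genBinom m n + genBinom m (n + 1) := by
  simp only [genBinom_eq_choose, Ring.choose_succ_succ, Int.cast_add]

theorem genBinom_natCast_s7 (j n : ℕ) : genBinom (j : ℤ) n = (j.choose n : ℂ) := by
  rw [genBinom_eq_choose, Ring.choose_natCast]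
  simp

/-- The sequence `m ↦ C(m,n) x^{m-n}`, the `n`-th divided derivative of `m ↦ x^m`. -/
noncomputable def binomPow (x : ℂ) (n : ℕ) (m : ℤ) : ℂ :=
  genBinom m n * x ^ (m - (n : ℤ))

/-- The shift operator on sequences indexed by `ℤ`. -/
def shiftEnd : Module.End ℂ (ℤ → ℂ) where
  toFun u m := u (m + 1)
  map_add' _ _ := rfl
  map_smul' _ _ := rfl

theorem shiftEnd_pow_apply (t : ℕ) (u : ℤ → ℂ) (m : ℤ) : (shiftEnd ^ t) u m = u (m + t) := by
  induction t generalizing m with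
  | zero => simp
  | succ t ih =>
    rw [pow_succ', Module.End.mul_apply]
    change (shiftEnd ^ t) u (m + 1) = _
    rw [ih]
    congr 1
    push_cast
    ring

theorem aeval_shiftEnd_apply (g : Polynomial ℂ) (u : ℤ → ℂ) (m : ℤ) :
    Polynomial.aeval shiftEnd g u m
      = ∑ t ∈ Finset.range (g.natDegree + 1), g.coeff t * u (m + t) := by
  rw [Polynomial.aeval_eq_sum_range]
  simp [LinearMap.sum_apply, Finset.sum_apply, shiftEnd_pow_apply]

theorem shiftEnd_sub_binomPow_zero {x : ℂ} (hx : x ≠ 0) :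
    Polynomial.aeval shiftEnd (Polynomial.X - Polynomial.C x) (binomPow x 0) = 0 := by
  ext m
  simp [binomPow, genBinom_zero_right, shiftEnd, zpow_add_one₀ hx, mul_comm]

theorem shiftEnd_sub_binomPow_succ {x : ℂ} (hx : x ≠ 0) (n : ℕ) :
    Polynomial.aeval shiftEnd (Polynomial.X - Polynomial.C x) (binomPow x (n + 1))
      = binomPow x n := by
  ext m
  have h : x ^ (m - (n : ℤ)) = x * x ^ (m - ((n : ℤ) + 1)) := by
    rw [← zpow_one_add₀ hx]
    congr 1
    ring
  simp [binomPow, shiftEnd, genBinom_succ_succ, h]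
  ring

theorem aeval_shiftEnd_binomPow {x : ℂ} (hx : x ≠ 0) {n r : ℕ} (hn : n < r) :
    Polynomial.aeval shiftEnd ((Polynomial.X - Polynomial.C x) ^ r) (binomPow x n) = 0 := by
  induction n generalizing r with
  | zero =>
    obtain ⟨r, rfl⟩ := Nat.exists_eq_succ_of_ne_zero hn.ne'
    rw [Nat.succ_eq_add_one, pow_succ, map_mul, Module.End.mul_apply,
      shiftEnd_sub_binomPow_zero hx, map_zero]
  | succ n ih =>
    obtain ⟨r, rfl⟩ := Nat.exists_eq_succ_of_ne_zero (Nat.ne_zero_of_lt hn)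
    rw [Nat.succ_eq_add_one, pow_succ, map_mul, Module.End.mul_apply,
      shiftEnd_sub_binomPow_succ hx, ih (by omega)]

theorem sum_coeff_mul_binomPow_eq_zero {g : Polynomial ℂ} {x : ℂ} (hx : x ≠ 0) {n r : ℕ}
    (hn : n < r) (hg : (Polynomial.X - Polynomial.C x) ^ r ∣ g) (m : ℤ) :
    ∑ t ∈ Finset.range (g.natDegree + 1), g.coeff t * binomPow x n (m + t) = 0 := by
  obtain ⟨q, rfl⟩ := hg
  rw [← aeval_shiftEnd_apply, mul_comm, map_mul, Module.End.mul_apply,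
    aeval_shiftEnd_binomPow hx hn, map_zero, Pi.zero_apply]

/-- A two-sided linear recurrence whose characteristic polynomial is monic of degree `R` with
nonzero constant term is determined by `R` consecutive values. -/
theorem eq_zero_of_recurrence {V : Type*} [AddCommGroup V] [Module ℂ V] {g : Polynomial ℂ}
    (hg : g.Monic) (hg0 : g.coeff 0 ≠ 0) {Y : ℤ → V}
    (hY : ∀ m : ℤ, ∑ t ∈ Finset.range (g.natDegree + 1), g.coeff t • Y (m + t) = 0)
    (h0 : ∀ j : ℕ, j < g.natDegree → Y j = 0) (m : ℤ) : Y m = 0 := by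
  have window : ∀ m : ℤ, ∀ j : ℕ, j < g.natDegree → Y (m + j) = 0 := by
    intro m
    induction m with
    | zero => simpa using h0
    | succ i ih =>
      intro j hj
      rcases Nat.lt_or_ge (j + 1) g.natDegree with h | h
      · convert ih (j + 1) h using 2
        push_cast
        ring
      · have := hY i
        rw [Finset.sum_range_succ, Finset.sum_eq_zero, zero_add, hg.coeff_natDegree,
          one_smul] at this
        · convert this using 2
          have : g.natDegree = j + 1 := by omega
          rw [this]
          push_cast
          ring
        · intro t ht
          rw [ih t (Finset.mem_range.mp ht), smul_zero]
    | pred i ih =>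
      intro j hj
      rcases j with _ | j
      · have := hY (-i - 1)
        rw [Finset.sum_range_succ', Finset.sum_eq_zero, zero_add] at this
        · exact (smul_eq_zero.mp this).resolve_left hg0
        · intro t ht
          have h := ih t (Finset.mem_range.mp ht)
          rw [show (-(i : ℤ) - 1 + ((t + 1 : ℕ) : ℤ)) = -i + t by push_cast; ring, h, smul_zero]
      · convert ih j (by omega) using 2
        push_cast
        ring
  rcases Nat.eq_zero_or_pos g.natDegree with h | h
  · simpa [h, hg0] using hY m
  · simpa using window m 0 h

theorem eval_hasseDeriv_eq_sum {p : Polynomial ℂ} {R : ℕ} (hp : p.degree < R) {x : ℂ}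
    (n : ℕ) :
    (Polynomial.hasseDeriv n p).eval x
      = ∑ j : Fin R, p.coeff j * binomPow x n ((j : ℕ) : ℤ) := by
  rw [Polynomial.hasseDeriv_apply, ← Polynomial.sum_fin _ (by simp) hp,
    Polynomial.eval_finsetSum]
  refine Finset.sum_congr rfl fun j _ => ?_
  rw [Polynomial.eval_monomial, binomPow, genBinom_natCast_s7]
  rcases Nat.lt_or_ge (j : ℕ) n with h | h
  · simp [Nat.choose_eq_zero_of_lt h]
  · rw [← Nat.cast_sub h, zpow_natCast]
    ring

/-- The confluent Vandermonde matrix with nodes `α k` of multiplicity `r k`. -/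
noncomputable def confluentVandermonde {l : ℕ} (α : Fin l → ℂ) (r : Fin l → ℕ) :
    Matrix (Fin (∑ k, r k)) (Σ k, Fin (r k)) ℂ :=
  Matrix.of fun j i => binomPow (α i.1) i.2 ((j : ℕ) : ℤ)

/-- The confluent Vandermonde matrix at pairwise distinct nodes is invertible. -/
theorem exists_inverse_confluentVandermonde {l : ℕ} {α : Fin l → ℂ} (hα : Function.Injective α)
    (r : Fin l → ℕ) :
    ∃ B : Matrix (Σ k, Fin (r k)) (Fin (∑ k, r k)) ℂ,
      B * confluentVandermonde α r = 1 ∧ confluentVandermonde α r * B = 1 := by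
  have hcard : Fintype.card (Σ k, Fin (r k)) = Fintype.card (Fin (∑ k, r k)) := by simp
  have hinj : Function.Injective (confluentVandermonde α r).vecMulLinear := by
    rw [← LinearMap.ker_eq_bot, LinearMap.ker_eq_bot']
    intro v hv
    set p : Polynomial ℂ := ((Polynomial.degreeLTEquiv ℂ (∑ k, r k)).symm v).1
    have hdeg : p.degree < (∑ k, r k : ℕ) :=
      Polynomial.mem_degreeLT.mp ((Polynomial.degreeLTEquiv ℂ (∑ k, r k)).symm v).2
    have hcoeff : ∀ j : Fin (∑ k, r k), p.coeff j = v j := fun j =>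
      congrFun ((Polynomial.degreeLTEquiv ℂ (∑ k, r k)).apply_symm_apply v) j
    have hdvd : (∏ k, (Polynomial.X - Polynomial.C (α k)) ^ (r k)) ∣ p := by
      refine Finset.prod_dvd_of_coprime (fun i _ j _ hij => ?_) fun k _ => ?_
      · exact (Polynomial.isCoprime_X_sub_C_of_isUnit_sub
          (sub_ne_zero.mpr (hα.ne hij)).isUnit).pow
      · rw [Polynomial.X_sub_C_pow_dvd_iff, ← Polynomial.taylor_apply, Polynomial.X_pow_dvd_iff]
        intro n hn
        rw [Polynomial.taylor_coeff, eval_hasseDeriv_eq_sum hdeg]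
        simpa [hcoeff, confluentVandermonde, Matrix.vecMul, dotProduct] using congrFun hv ⟨k, n, hn⟩
    have hp0 : p = 0 := by
      refine Polynomial.eq_zero_of_dvd_of_degree_lt hdvd ?_
      rw [Polynomial.degree_prod]
      simpa [Polynomial.degree_pow] using hdeg
    ext j
    rw [← hcoeff, hp0]
    simp
  have hsurj : Function.Surjective (confluentVandermonde α r).vecMulLinear :=
    (LinearMap.injective_iff_surjective_of_finrank_eq_finrank
      (by simp [Module.finrank_fintype_fun_eq_card])).mp hinj
  obtain ⟨B, hB⟩ := Matrix.vecMul_surjective_iff_exists_left_inverse.mp hsurj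
  exact ⟨B, hB, (Matrix.mul_eq_one_comm_of_card_eq _ _ _ hcard).mp hB⟩

theorem sum_smul_smul_of_mul_eq_one {ι κ V : Type*} [Fintype ι] [Fintype κ] [DecidableEq ι]
    [AddCommGroup V] [Module ℂ V] {A : Matrix ι κ ℂ} {B : Matrix κ ι ℂ} (h : A * B = 1)
    (v : ι → V) (i : ι) : ∑ k, A i k • ∑ j, B k j • v j = v i := by
  simp_rw [Finset.smul_sum, smul_smul]
  rw [Finset.sum_comm]
  simp_rw [← Finset.sum_smul, ← Matrix.mul_apply, h, Matrix.one_apply, ite_smul, one_smul,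
    zero_smul]
  simp

theorem monic_prod_X_sub_C_pow {l : ℕ} (α : Fin l → ℂ) (r : Fin l → ℕ) :
    (∏ k, (Polynomial.X - Polynomial.C (α k)) ^ (r k)).Monic :=
  Polynomial.monic_prod_of_monic _ _ fun k _ => (Polynomial.monic_X_sub_C (α k)).pow (r k)

theorem natDegree_prod_X_sub_C_pow {l : ℕ} (α : Fin l → ℂ) (r : Fin l → ℕ) :
    (∏ k, (Polynomial.X - Polynomial.C (α k)) ^ (r k)).natDegree = ∑ k, r k := by
  rw [Polynomial.natDegree_prod_of_monic _ _ fun k _ => (Polynomial.monic_X_sub_C (α k)).pow (r k)]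
  simp

theorem coeff_zero_prod_X_sub_C_pow_ne_zero {l : ℕ} {α : Fin l → ℂ} (hα0 : ∀ k, α k ≠ 0)
    (r : Fin l → ℕ) : (∏ k, (Polynomial.X - Polynomial.C (α k)) ^ (r k)).coeff 0 ≠ 0 := by
  rw [Polynomial.coeff_zero_eq_eval_zero, Polynomial.eval_prod]
  exact Finset.prod_ne_zero_iff.mpr fun k _ => by simp [hα0 k]

/-- A solution of the recurrence with characteristic polynomial `Π_k (x - α_k)^{r_k}` is a
combination of the sequences `binomPow (α k) n`, `n < r k`, with the coefficients read off from
its values at `0, …, R - 1`. -/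
theorem eq_sum_binomPow_of_recurrence {V : Type*} [AddCommGroup V] [Module ℂ V] {l : ℕ}
    {α : Fin l → ℂ} (hα0 : ∀ k, α k ≠ 0) {r : Fin l → ℕ}
    {B : Matrix (Σ k, Fin (r k)) (Fin (∑ k, r k)) ℂ}
    (hB : confluentVandermonde α r * B = 1) {X : ℤ → V}
    (hX : ∀ m : ℤ, ∑ t ∈ Finset.range ((∑ k, r k) + 1),
      (∏ k, (Polynomial.X - Polynomial.C (α k)) ^ (r k)).coeff t • X (m + t) = 0) (m : ℤ) :
    X m = ∑ i : Σ k, Fin (r k), binomPow (α i.1) i.2 m • ∑ j, B i j • X ((j : ℕ) : ℤ) := by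
  set g : Polynomial ℂ := ∏ k, (Polynomial.X - Polynomial.C (α k)) ^ (r k) with hg
  have hdeg : g.natDegree = ∑ k, r k := natDegree_prod_X_sub_C_pow α r
  rw [← sub_eq_zero]
  refine eq_zero_of_recurrence
    (Y := fun m => X m - ∑ i : Σ k, Fin (r k), binomPow (α i.1) i.2 m •
      ∑ j, B i j • X ((j : ℕ) : ℤ))
    (monic_prod_X_sub_C_pow α r) (coeff_zero_prod_X_sub_C_pow_ne_zero hα0 r) ?_ ?_ m
  · intro m
    rw [← hg]
    simp_rw [smul_sub, Finset.sum_sub_distrib]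
    rw [hdeg, hX, zero_sub, neg_eq_zero]
    simp_rw [Finset.smul_sum (s := (Finset.univ : Finset (Σ k, Fin (r k)))), smul_smul]
    rw [Finset.sum_comm]
    refine Finset.sum_eq_zero fun i _ => ?_
    have h := sum_coeff_mul_binomPow_eq_zero (g := g) (hα0 i.1) i.2.2
      (Finset.dvd_prod_of_mem _ (Finset.mem_univ i.1)) m
    rw [hdeg] at h
    rw [← Finset.sum_smul, h, zero_smul]
  · intro j hj
    rw [← hg, hdeg] at hj
    exact sub_eq_zero.mpr
      (sum_smul_smul_of_mul_eq_one hB (fun j => X ((j : ℕ) : ℤ)) ⟨j, hj⟩).symm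

theorem IsFieldSeries.exists_lie_apply_eq_zero {W : Type} [AddCommGroup W] [Module ℂ W]
    (a : ℤ → Module.End ℂ W) {b : ℤ → Module.End ℂ W} (hb : IsFieldSeries b) (j : ℤ) (w : W) :
    ∃ N : ℤ, ∀ s ≥ N, ⁅a j, b (s - j)⁆ w = 0 := by
  obtain ⟨N, hN⟩ := hb w
  obtain ⟨M, hM⟩ := hb (a j w)
  refine ⟨max N M + j, fun s hs => ?_⟩
  have h₁ : N ≤ s - j := by have := le_max_left N M; omega
  have h₂ : M ≤ s - j := by have := le_max_right N M; omega
  simp [Ring.lie_def, hN _ h₁, hM _ h₂]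

theorem isFieldSeries_sum_smul {W : Type} [AddCommGroup W] [Module ℂ W] {ι : Type*} [Fintype ι]
    {x : ι → ℤ → Module.End ℂ W} (hx : ∀ i, IsFieldSeries (x i)) (β : ι → ℂ) (n : ℤ) :
    IsFieldSeries fun q => ∑ i, β i • x i (q + n) := by
  intro w
  choose N hN using fun i => hx i w
  obtain ⟨M, hM⟩ := Finite.bddAbove_range N
  refine ⟨M - n, fun q hq => ?_⟩
  rw [LinearMap.sum_apply]
  refine Finset.sum_eq_zero fun i _ => ?_
  have : N i ≤ M := hM ⟨i, rfl⟩
  rw [LinearMap.smul_apply, hN i _ (by omega), smul_zero]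

/-- if `f(z,w) = Π_k (z - α_k w)^{r_k}` kills the commutator `[a(z), b(w)]`
(coefficientwise; note `f(z,w) = Σ_t g_t z^t w^{R-t}` where `g(x) = Π_k (x - α_k)^{r_k}`
and `R = Σ_k r_k`, so that the coefficient of `z^{-m-1} w^{-p-1}` in `f·[a(z),b(w)]` is
`Σ_t g_t [a_{m+t}, b_{p+R-t}]`), then the commutator has a unique expansion
`[a(z),b(w)] = Σ_k Σ_{n<r_k} c_{k,n}(w) δ^{(α_k,n)}(z,w)` with `c_{k,n} ∈ E(W)`;
coefficientwise, `[a_m, b_p] = Σ_k Σ_{n<r_k} C(m,n) α_k^{m-n} c_{k,n}(m-n+p)`. -/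
theorem stmt7 (W : Type) [AddCommGroup W] [Module ℂ W]
    (a b : ℤ → Module.End ℂ W)
    (ha : IsFieldSeries a) (hb : IsFieldSeries b)
    (l : ℕ) (hl : 0 < l)
    (α : Fin l → ℂ) (hα0 : ∀ k, α k ≠ 0) (hαinj : Function.Injective α)
    (r : Fin l → ℕ) (hr : ∀ k, 0 < r k)
    (hloc : ∀ m p : ℤ,
      ∑ t ∈ Finset.range ((∑ k, r k) + 1),
        ((∏ k, (Polynomial.X - Polynomial.C (α k)) ^ (r k)).coeff t) •
          ⁅a (m + (t : ℤ)), b (p + ((∑ k, r k : ℕ) : ℤ) - (t : ℤ))⁆ = 0) :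
    ∃! c : Fin l → ℕ → ℤ → Module.End ℂ W,
      (∀ (k : Fin l) (n : ℕ), n < r k → IsFieldSeries (c k n)) ∧
      (∀ (k : Fin l) (n : ℕ), r k ≤ n → c k n = 0) ∧
      (∀ m p : ℤ, ⁅a m, b p⁆ =
        ∑ k : Fin l, ∑ n ∈ Finset.range (r k),
          (genBinom m n * (α k) ^ (m - (n : ℤ))) • c k n (m - (n : ℤ) + p)) := by
  obtain ⟨B, hBA, hAB⟩ := exists_inverse_confluentVandermonde hαinj r
  have hsum : ∀ (c : Fin l → ℕ → ℤ → Module.End ℂ W) (s m : ℤ),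
      ∑ k : Fin l, ∑ n ∈ Finset.range (r k),
          (genBinom m n * (α k) ^ (m - (n : ℤ))) • c k n (m - (n : ℤ) + (s - m))
        = ∑ i : Σ k, Fin (r k), binomPow (α i.1) i.2 m • c i.1 i.2 (s - ((i.2 : ℕ) : ℤ)) := by
    intro c s m
    rw [Fintype.sum_sigma]
    refine Finset.sum_congr rfl fun k _ => ?_
    rw [Finset.sum_range]
    refine Finset.sum_congr rfl fun n _ => ?_
    rw [binomPow]
    congr 2
    ring
  refine ⟨fun k n q => if h : n < r k then
    ∑ j : Fin (∑ k, r k), B ⟨k, n, h⟩ j •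
      ⁅a ((j : ℕ) : ℤ), b (q + (n : ℤ) - ((j : ℕ) : ℤ))⁆ else 0, ⟨?_, ?_, ?_⟩, ?_⟩
  · intro k n hn
    simp only [dif_pos hn]
    exact isFieldSeries_sum_smul
      (x := fun (j : Fin (∑ k, r k)) s => ⁅a ((j : ℕ) : ℤ), b (s - ((j : ℕ) : ℤ))⁆)
      (fun j w => hb.exists_lie_apply_eq_zero a j w) _ _
  · intro k n hn
    ext1 q
    simp [hn.not_gt]
  · intro m p
    have h := hsum (fun k n q => if h : n < r k then
      ∑ j : Fin (∑ k, r k), B ⟨k, n, h⟩ j •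
        ⁅a ((j : ℕ) : ℤ), b (q + (n : ℤ) - ((j : ℕ) : ℤ))⁆ else 0) (m + p) m
    rw [add_sub_cancel_left] at h
    rw [h]
    have hX := eq_sum_binomPow_of_recurrence hα0 hAB
      (X := fun m' => ⁅a m', b (m + p - m')⁆) (fun m' => by
        convert hloc m' (m + p - m' - ((∑ k, r k : ℕ) : ℤ)) using 5
        ring_nf) m
    simpa using hX
  · rintro c ⟨-, hc0, hc⟩
    ext1 k
    ext1 n
    ext1 q
    split_ifs with hn
    · have hX : ∀ j : Fin (∑ k, r k),
          ⁅a ((j : ℕ) : ℤ), b (q + (n : ℤ) - ((j : ℕ) : ℤ))⁆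
            = ∑ i : Σ k, Fin (r k), binomPow (α i.1) i.2 ((j : ℕ) : ℤ) •
              c i.1 i.2 (q + (n : ℤ) - ((i.2 : ℕ) : ℤ)) := fun j => by
        rw [hc, hsum]
      simp_rw [hX]
      have := sum_smul_smul_of_mul_eq_one hBA
        (fun i => c i.1 i.2 (q + (n : ℤ) - ((i.2 : ℕ) : ℤ))) ⟨k, n, hn⟩
      simpa [confluentVandermonde] using this.symm
    · rw [hc0 k n (not_lt.mp hn), Pi.zero_apply]
end
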